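/- arXiv:1907.06461 — 2 statements merged into one kernel-verified Lean document; each statement's English description precedes it below -/
import Mathlib

section
/- Let n ≥ 3. There exists a Lipschitz homeomorphism g : 𝔹 ∖ I → 𝔹 from the slit ball onto the unit ball (in particular g has finite conformal energy) whose inverse h = g⁻¹ : 𝔹 → 𝔹 ∖ I belongs to W^{1,p}(𝔹, ℝⁿ) for every exponent 1 ≤ p < n. -/
open MeasureTheory Metric Set
open scoped ENNReal NNReal

noncomputable section

abbrev Euc (n : ℕ) : Type := EuclideanSpace ℝ (Fin n)

/-- Operator norm of an `n × n` real matrix, viewed as a linear operator on Euclidean space. -/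
noncomputable def opNorm {n : ℕ} (M : Matrix (Fin n) (Fin n) ℝ) : ℝ :=
  ‖LinearMap.toContinuousLinearMap (Matrix.toEuclideanLin M)‖

/-- `g` belongs to the Sobolev class `W^{1,p}(Ω, ℝⁿ)` with weak differential `Dg`:
`g` and `Dg` are locally integrable on `Ω`, the integration-by-parts identity holds against
every smooth compactly supported test function supported in `Ω`, and `|Dg| ∈ L^p(Ω)`. -/
structure MemSobolev {n : ℕ} (p : ℝ) (Ω : Set (Euc n))
    (g : Euc n → Euc n) (Dg : Euc n → Matrix (Fin n) (Fin n) ℝ) : Prop where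
  locInt : ∀ i : Fin n, LocallyIntegrableOn (fun x => g x i) Ω volume
  locIntD : ∀ i j : Fin n, LocallyIntegrableOn (fun x => Dg x i j) Ω volume
  parts : ∀ φ : Euc n → ℝ, ContDiff ℝ ((⊤ : ℕ∞) : WithTop ℕ∞) φ → HasCompactSupport φ →
    tsupport φ ⊆ Ω → ∀ i j : Fin n,
      ∫ x in Ω, g x i * fderiv ℝ φ x (EuclideanSpace.single j 1) =
        - ∫ x in Ω, Dg x i j * φ x
  lp : IntegrableOn (fun x => opNorm (Dg x) ^ p) Ω volume

/-- `g` belongs to the local Sobolev class `W^{1,1}_loc(Ω, ℝⁿ)` with weak differential `Dg`. -/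
structure MemSobolevLoc {n : ℕ} (Ω : Set (Euc n))
    (g : Euc n → Euc n) (Dg : Euc n → Matrix (Fin n) (Fin n) ℝ) : Prop where
  locInt : ∀ i : Fin n, LocallyIntegrableOn (fun x => g x i) Ω volume
  locIntD : ∀ i j : Fin n, LocallyIntegrableOn (fun x => Dg x i j) Ω volume
  parts : ∀ φ : Euc n → ℝ, ContDiff ℝ ((⊤ : ℕ∞) : WithTop ℕ∞) φ → HasCompactSupport φ →
    tsupport φ ⊆ Ω → ∀ i j : Fin n,
      ∫ x in Ω, g x i * fderiv ℝ φ x (EuclideanSpace.single j 1) =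
        - ∫ x in Ω, Dg x i j * φ x

/-- `h : 𝕏 → 𝕐` is a homeomorphism of `𝕏` onto `𝕐` with inverse `f`. -/
structure IsHomeoOn {n : ℕ} (h f : Euc n → Euc n) (𝕏 𝕐 : Set (Euc n)) : Prop where
  mapsTo : Set.MapsTo h 𝕏 𝕐
  mapsTo_inv : Set.MapsTo f 𝕐 𝕏
  left_inv : ∀ x ∈ 𝕏, f (h x) = x
  right_inv : ∀ y ∈ 𝕐, h (f y) = y
  continuousOn : ContinuousOn h 𝕏
  continuousOn_inv : ContinuousOn f 𝕐

/-- The inner distortion function `K_I(·, h)` of a Sobolev map with weak differential `Dh`;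
`D♯h` is the cofactor (adjugate) matrix, given by Cramer's rule `(D♯h)(Dh) = (det Dh)·Id`. -/
noncomputable def innerDistortion {n : ℕ} (Dh : Euc n → Matrix (Fin n) (Fin n) ℝ)
    (x : Euc n) : ℝ≥0∞ :=
  if 0 < (Dh x).det then
    ENNReal.ofReal (opNorm ((Dh x).adjugate) ^ n / (Dh x).det ^ (n - 1))
  else if (Dh x).adjugate = 0 then 1 else ⊤

/-- The open unit ball `𝔹 ⊂ ℝⁿ`. -/
def unitBall (n : ℕ) : Set (Euc n) := Metric.ball 0 1

/-- The slit `I = {(t,0) : 0 ≤ t < 1}`, the first coordinate playing the role of `t`. -/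
def slit (n : ℕ) [NeZero n] : Set (Euc n) :=
  {p | 0 ≤ p 0 ∧ p 0 < 1 ∧ ∀ i : Fin n, i ≠ 0 → p i = 0}

/-- The model inward-cusp ball `𝔹_u = 𝔹 \ {(t,x) : t ≥ 0, |x| ≤ u(t)}`. -/
noncomputable def cuspBall (n : ℕ) [NeZero n] (u : ℝ → ℝ) : Set (Euc n) :=
  Metric.ball 0 1 \
    {p | 0 ≤ p 0 ∧ Real.sqrt (∑ i ∈ Finset.univ.erase (0 : Fin n), p i ^ 2) ≤ u (p 0)}

/-- `u` is a model cusp profile: a strictly increasing continuous surjection of `[0,∞)` onto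
itself, `C¹` on `(0,∞)`, with `u′` increasing on `(0,∞)`, `u′(s) → 0` as `s → 0⁺`, `u(1) = 1`. -/
structure IsModelCusp (u : ℝ → ℝ) : Prop where
  continuousOn : ContinuousOn u (Set.Ici 0)
  contDiffOn : ContDiffOn ℝ 1 u (Set.Ioi 0)
  strictMonoOn : StrictMonoOn u (Set.Ici 0)
  mapsTo : Set.MapsTo u (Set.Ici 0) (Set.Ici 0)
  surjOn : Set.SurjOn u (Set.Ici 0) (Set.Ici 0)
  deriv_mono : MonotoneOn (deriv u) (Set.Ioi 0)
  deriv_tendsto : Filter.Tendsto (deriv u) (nhdsWithin 0 (Set.Ioi 0)) (nhds 0)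
  one : u 1 = 1

/-- The cusp profile `u(t) = e / exp(t^{-α})` for `t > 0`, and `u(0) = 0`. -/
noncomputable def cuspFun (α : ℝ) (t : ℝ) : ℝ :=
  if 0 < t then Real.exp 1 / Real.exp (t ^ (-α)) else 0

/-- The sphere `S_t = {y ∈ 𝔹_u : |y| = t}` inside the cusp ball. -/
def cuspS (n : ℕ) [NeZero n] (u : ℝ → ℝ) (t : ℝ) : Set (Euc n) :=
  {y ∈ cuspBall n u | ‖y‖ = t}

/-- The boundary circle `C_t = {y ∈ ∂𝔹_u : |y| = t}`. -/
def cuspC (n : ℕ) [NeZero n] (u : ℝ → ℝ) (t : ℝ) : Set (Euc n) :=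
  {y ∈ frontier (cuspBall n u) | ‖y‖ = t}

/-- `S′_t = h⁻¹(S_t) ⊆ 𝔹`. -/
def cuspS' (n : ℕ) [NeZero n] (u : ℝ → ℝ) (h : Euc n → Euc n) (t : ℝ) : Set (Euc n) :=
  {x ∈ unitBall n | h x ∈ cuspS n u t}

/-- `C′_t = cl(S′_t) ∩ ∂𝔹`. -/
def cuspC' (n : ℕ) [NeZero n] (u : ℝ → ℝ) (h : Euc n → Euc n) (t : ℝ) : Set (Euc n) :=
  closure (cuspS' n u h t) ∩ Metric.sphere (0 : Euc n) 1

/-! ### Weak derivatives of locally Lipschitz maps -/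

theorem aux_ext {n : ℕ} {Ω : Set (Euc n)} (hΩ : IsOpen Ω) {f : Euc n → ℝ}
    (hf : ∀ K : Set (Euc n), IsCompact K → K ⊆ Ω → ∃ L : ℝ≥0, LipschitzOnWith L f K)
    {K : Set (Euc n)} (hK : IsCompact K) (hKΩ : K ⊆ Ω) :
    ∃ (F : Euc n → ℝ) (L : ℝ≥0), LipschitzWith L F ∧ ∀ x ∈ K, f =ᶠ[nhds x] F := by
  obtain ⟨K', hK', h1, h2⟩ := exists_compact_between hK hΩ hKΩ
  obtain ⟨L, hL⟩ := hf K' hK' h2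
  obtain ⟨F, hF, hE⟩ := hL.extend_real
  refine ⟨F, L, hF, fun x hx => ?_⟩
  filter_upwards [isOpen_interior.mem_nhds (h1 hx)] with y hy
  exact hE (interior_subset hy)

theorem aux_cont {n : ℕ} {Ω : Set (Euc n)} (hΩ : IsOpen Ω) {f : Euc n → ℝ}
    (hf : ∀ K : Set (Euc n), IsCompact K → K ⊆ Ω → ∃ L : ℝ≥0, LipschitzOnWith L f K) :
    ContinuousOn f Ω := by
  intro x hx
  obtain ⟨F, L, hF, hE⟩ := aux_ext hΩ hf (isCompact_singleton (x := x))
    (by simpa using hx)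
  exact (hF.continuous.continuousAt.congr (hE x rfl).symm).continuousWithinAt

theorem aux_locInt {n : ℕ} {Ω : Set (Euc n)} (hΩ : IsOpen Ω) {f : Euc n → ℝ}
    (hf : ∀ K : Set (Euc n), IsCompact K → K ⊆ Ω → ∃ L : ℝ≥0, LipschitzOnWith L f K)
    (v : Euc n) :
    LocallyIntegrableOn (fun x => lineDeriv ℝ f x v) Ω volume := by
  rw [locallyIntegrableOn_iff hΩ.isLocallyClosed]
  intro K hKΩ hK
  obtain ⟨F, L, hF, hE⟩ := aux_ext hΩ hf hK hKΩ
  have h1 : IntegrableOn (fun x => lineDeriv ℝ F x v) K volume := by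
    refine Measure.integrableOn_of_bounded (M := L * ‖v‖) hK.measure_lt_top.ne
      (measurable_lineDeriv hF.continuous).aestronglyMeasurable ?_
    exact Filter.Eventually.of_forall fun x => norm_lineDeriv_le_of_lipschitz ℝ hF
  refine h1.congr_fun (fun x hx => ?_) hK.measurableSet
  exact (hE x hx).lineDeriv_eq.symm

theorem aux_parts {n : ℕ} {Ω : Set (Euc n)} (hΩ : IsOpen Ω) {f : Euc n → ℝ}
    (hf : ∀ K : Set (Euc n), IsCompact K → K ⊆ Ω → ∃ L : ℝ≥0, LipschitzOnWith L f K)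
    (v : Euc n) (φ : Euc n → ℝ) (hφ : ContDiff ℝ ((⊤ : ℕ∞) : WithTop ℕ∞) φ)
    (hc : HasCompactSupport φ) (hs : tsupport φ ⊆ Ω) :
    ∫ x in Ω, f x * fderiv ℝ φ x v = - ∫ x in Ω, lineDeriv ℝ f x v * φ x := by
  obtain ⟨F, L, hF, hE⟩ := aux_ext hΩ hf hc hs
  obtain ⟨D, hD⟩ := ContDiff.lipschitzWith_of_hasCompactSupport hc hφ (by simp)
  have key := hF.integral_lineDeriv_mul_eq (μ := (volume : Measure (Euc n))) hD hc v
  have hfd : ∀ x, x ∉ tsupport φ → fderiv ℝ φ x = 0 := fun x hx =>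
    image_eq_zero_of_notMem_tsupport (fun h => hx (tsupport_fderiv_subset ℝ h))
  have hφ0 : ∀ x, x ∉ tsupport φ → φ x = 0 := fun x hx => image_eq_zero_of_notMem_tsupport hx
  have e1 : ∫ x in Ω, f x * fderiv ℝ φ x v = ∫ x, F x * fderiv ℝ φ x v := by
    rw [setIntegral_eq_integral_of_forall_compl_eq_zero]
    · refine integral_congr_ae (Filter.Eventually.of_forall fun x => ?_)
      by_cases hx : x ∈ tsupport φ
      · simp only [(hE x hx).eq_of_nhds]
      · simp [hfd x hx]
    · intro x hx
      simp [hfd x (fun h => hx (hs h))]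
  have e2 : ∫ x in Ω, lineDeriv ℝ f x v * φ x = ∫ x, lineDeriv ℝ F x v * φ x := by
    rw [setIntegral_eq_integral_of_forall_compl_eq_zero]
    · refine integral_congr_ae (Filter.Eventually.of_forall fun x => ?_)
      by_cases hx : x ∈ tsupport φ
      · simp only [(hE x hx).lineDeriv_eq]
      · simp [hφ0 x hx]
    · intro x hx
      simp [hφ0 x (fun h => hx (hs h))]
  rw [e1, e2, key, ← integral_neg]
  refine integral_congr_ae (Filter.Eventually.of_forall fun x => ?_)
  simp only
  rw [((hφ.differentiable (by simp)).differentiableAt).lineDeriv_eq_fderiv]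
  simp [mul_comm]

theorem opNorm_le {n : ℕ} : ∃ C : ℝ, 0 ≤ C ∧ ∀ (M : Matrix (Fin n) (Fin n) ℝ) (b : ℝ),
    (∀ i j, |M i j| ≤ b) → opNorm M ≤ C * b := by
  refine ⟨∑ i, ∑ j, opNorm (Matrix.single i j (1 : ℝ) : Matrix (Fin n) (Fin n) ℝ),
    Finset.sum_nonneg fun i _ => Finset.sum_nonneg fun j _ => norm_nonneg _, ?_⟩
  intro M b hb
  have h : opNorm M ≤ ∑ i, ∑ j, opNorm (Matrix.single i j (M i j)) := by
    conv_lhs => rw [Matrix.matrix_eq_sum_single M]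
    unfold opNorm
    simp only [map_sum]
    refine (norm_sum_le _ _).trans (Finset.sum_le_sum fun i _ => norm_sum_le _ _)
  refine h.trans ?_
  rw [Finset.sum_mul]
  refine Finset.sum_le_sum fun i _ => ?_
  rw [Finset.sum_mul]
  refine Finset.sum_le_sum fun j _ => ?_
  have h2 : (Matrix.single i j (M i j) : Matrix (Fin n) (Fin n) ℝ)
      = M i j • Matrix.single i j (1 : ℝ) := by
    rw [Matrix.smul_single]; simp
  have h3 : opNorm (Matrix.single i j (M i j) : Matrix (Fin n) (Fin n) ℝ)
      = |M i j| * opNorm (Matrix.single i j (1 : ℝ) : Matrix (Fin n) (Fin n) ℝ) := by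
    rw [h2]; unfold opNorm
    rw [map_smul, map_smul, norm_smul, Real.norm_eq_abs]
  rw [h3, mul_comm]
  exact mul_le_mul_of_nonneg_left (hb i j) (norm_nonneg _)

theorem opNorm_cont {n : ℕ} : Continuous (opNorm : Matrix (Fin n) (Fin n) ℝ → ℝ) := by
  unfold opNorm
  refine continuous_norm.comp ?_
  exact LinearMap.continuous_of_finiteDimensional
    (((LinearMap.toContinuousLinearMap (𝕜 := ℝ) (E := Euc n) (F' := Euc n)).toLinearMap).comp
      (Matrix.toEuclideanLin (𝕜 := ℝ) (m := Fin n) (n := Fin n)).toLinearMap)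

theorem memSobolev_of_lip {n : ℕ} {Ω : Set (Euc n)} (hΩ : IsOpen Ω) {f : Euc n → Euc n}
    (hf : ∀ i, ∀ K : Set (Euc n), IsCompact K → K ⊆ Ω →
      ∃ L : ℝ≥0, LipschitzOnWith L (fun x => f x i) K)
    {p : ℝ} (hp : 0 ≤ p) (b : Euc n → ℝ)
    (hb0 : ∀ x, 0 ≤ b x)
    (hb : ∀ x ∈ Ω, ∀ i, ∀ᶠ y in nhds x, |f y i - f x i| ≤ b x * ‖y - x‖)
    (hint : IntegrableOn (fun x => b x ^ p) Ω volume) :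
    ∃ Dg, MemSobolev p Ω f Dg := by
  have hD := fun i j : Fin n => aux_locInt hΩ (hf i) (EuclideanSpace.single j 1)
  refine ⟨fun x => Matrix.of fun i j =>
    lineDeriv ℝ (fun y => f y i) x (EuclideanSpace.single j 1), ?_, ?_, ?_, ?_⟩
  · intro i
    exact (aux_cont hΩ (hf i)).locallyIntegrableOn hΩ.measurableSet
  · exact hD
  · intro φ h1 h2 h3 i j
    exact aux_parts hΩ (hf i) _ φ h1 h2 h3
  · obtain ⟨C, hC0, hC⟩ := opNorm_le (n := n)
    refine Integrable.mono' (g := fun x => C ^ p * b x ^ p) (hint.const_mul _) ?_ ?_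
    · have hm : AEMeasurable (fun x => (fun i j =>
          lineDeriv ℝ (fun y => f y i) x (EuclideanSpace.single j 1) :
            Fin n → Fin n → ℝ)) (volume.restrict Ω) := by
        refine aemeasurable_pi_lambda _ fun i => aemeasurable_pi_lambda _ fun j => ?_
        exact (hD i j).aestronglyMeasurable.aemeasurable
      have hc : Continuous (fun M : Fin n → Fin n → ℝ => opNorm (Matrix.of M) ^ p) :=
        (opNorm_cont (n := n)).rpow_const fun x => Or.inr hp
      exact (hc.measurable.comp_aemeasurable hm).aestronglyMeasurable
    · refine (ae_restrict_mem hΩ.measurableSet).mono fun x hx => ?_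
      rw [Real.norm_of_nonneg (Real.rpow_nonneg (show 0 ≤ opNorm _ from norm_nonneg _) _),
        ← Real.mul_rpow hC0 (hb0 x)]
      refine Real.rpow_le_rpow (norm_nonneg _) (hC _ _ fun i j => ?_) hp
      have := norm_lineDeriv_le_of_lip' ℝ (f := fun y => f y i) (x₀ := x)
        (v := (EuclideanSpace.single j 1 : Euc n))
        (hb0 x) (hb x hx i)
      simpa using this

/-! ### The profile -/

def ww (r : ℝ) : ℝ := (1 - r) * Real.sqrt (1 - r ^ 2)

theorem ww_lip_aux {a b : ℝ} (ha : 0 ≤ a) (hab : a ≤ b) (hb : b ≤ 1) :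
    0 ≤ ww a - ww b ∧ ww a - ww b ≤ 3 * (b - a) := by
  unfold ww
  have hA : 0 ≤ 1 - a ^ 2 := by nlinarith
  have hB : 0 ≤ 1 - b ^ 2 := by nlinarith
  have h1 := Real.sq_sqrt hA
  have h2 := Real.sq_sqrt hB
  have h3 := Real.sqrt_nonneg (1 - a ^ 2)
  have h4 := Real.sqrt_nonneg (1 - b ^ 2)
  have h5 : Real.sqrt (1 - b ^ 2) ≤ Real.sqrt (1 - a ^ 2) := Real.sqrt_le_sqrt (by nlinarith)
  have h6 : 1 - b ≤ Real.sqrt (1 - a ^ 2) := Real.le_sqrt_of_sq_le (by nlinarith)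
  have h7 : Real.sqrt (1 - a ^ 2) ≤ 1 := Real.sqrt_le_one.mpr (by nlinarith)
  set s := Real.sqrt (1 - a ^ 2)
  set t := Real.sqrt (1 - b ^ 2)
  constructor
  · nlinarith [mul_nonneg (sub_nonneg.2 hab) h3, mul_nonneg (sub_nonneg.2 hb) (sub_nonneg.2 h5)]
  · have k1 : (b - a) * s ≤ (b - a) := by nlinarith
    have k2 : (1 - b) * (s - t) ≤ s * (s - t) :=
      mul_le_mul_of_nonneg_right h6 (sub_nonneg.2 h5)
    have k3 : s * (s - t) ≤ s ^ 2 - t ^ 2 := by nlinarith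
    have k4 : s ^ 2 - t ^ 2 ≤ 2 * (b - a) := by rw [h1, h2]; nlinarith
    nlinarith

theorem ww_lip {a b : ℝ} (ha : 0 ≤ a) (ha1 : a ≤ 1) (hb : 0 ≤ b) (hb1 : b ≤ 1) :
    |ww a - ww b| ≤ 3 * |a - b| := by
  rcases le_total a b with h | h
  · obtain ⟨h1, h2⟩ := ww_lip_aux ha h hb1
    rw [abs_of_nonneg h1, abs_of_nonpos (by linarith)]; linarith
  · obtain ⟨h1, h2⟩ := ww_lip_aux hb h ha1
    rw [abs_of_nonpos (by linarith), abs_of_nonneg (by linarith)]; linarith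

def HH (u r : ℝ) : ℝ := if 0 ≤ u then u / r else u / (2 - r)

theorem HH_bound {u r s : ℝ} (hr : 0 ≤ r) (hr1 : r ≤ 1) (h1 : u < r * s)
    (h2 : -((2 - r) * s) < u) (hs : s ≤ 1) :
    HH u r < s ∧ -s < HH u r ∧ |HH u r| ≤ 1 := by
  unfold HH
  split_ifs with h
  · have hr0 : 0 < r := by
      rcases hr.eq_or_lt with h' | h'
      · rw [← h'] at h1; linarith
      · exact h'
    have hs0 : 0 < s := by by_contra hh; nlinarith
    have k1 : u / r < s := by rw [div_lt_iff₀ hr0]; linarith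
    have k2 : 0 ≤ u / r := by positivity
    refine ⟨k1, by linarith, abs_le.2 ⟨by linarith, by linarith⟩⟩
  · have h' : 0 < 2 - r := by linarith
    have k1 : u / (2 - r) < 0 := div_neg_of_neg_of_pos (by linarith) h'
    have k2 : -s < u / (2 - r) := by rw [lt_div_iff₀ h']; linarith
    have hs0 : 0 < s := by linarith
    refine ⟨by linarith, k2, abs_le.2 ⟨by linarith, by linarith⟩⟩

theorem HH_lip_pos {u r u' r' : ℝ} (hr : 0 < r) (hr1 : r ≤ 1) (hr1' : r' ≤ 1)
    (hu : 0 ≤ u) (hr' : 0 ≤ u' → 0 < r') (hH' : |HH u' r'| ≤ 1) :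
    |HH u' r' - HH u r| ≤ (|u' - u| + |r' - r|) / r := by
  rw [le_div_iff₀ hr]
  by_cases hu' : 0 ≤ u'
  · have hr0' := hr' hu'
    simp only [HH, hu, hu', if_true] at hH' ⊢
    set q := u' / r' with hq
    have e : u' = q * r' := by rw [hq]; field_simp
    have e2 : (q - u / r) * r = (u' - u) - q * (r' - r) := by
      rw [e]; field_simp; ring
    rw [← abs_of_pos hr, ← abs_mul, abs_of_pos hr, e2]
    refine (abs_sub _ _).trans ?_
    rw [abs_mul]
    nlinarith [abs_nonneg (r' - r)]
  · simp only [HH, hu, hu', if_true, if_false]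
    push Not at hu'
    have k : 0 < 2 - r' := by linarith
    have k1 : u' / (2 - r') < 0 := div_neg_of_neg_of_pos hu' k
    have k2 : 0 ≤ u / r := by positivity
    have k3 : u / r * r = u := by field_simp
    have k4 : u' / (2 - r') * (2 - r') = u' := by field_simp
    have k5 : u' ≤ u' / (2 - r') * r := by nlinarith
    rw [abs_of_neg (by linarith), abs_of_neg (by linarith : u' - u < 0)]
    nlinarith [abs_nonneg (r' - r)]

theorem HH_lip_neg {u r u' r' : ℝ} (hr1 : r ≤ 1) (hr1' : r' ≤ 1)
    (hu : u < 0) (hu' : u' < 0) (hH' : |HH u' r'| ≤ 1) :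
    |HH u' r' - HH u r| ≤ |u' - u| + |r' - r| := by
  have k : 0 < 2 - r' := by linarith
  have k0 : 1 ≤ 2 - r := by linarith
  simp only [HH, not_le.2 hu, not_le.2 hu', if_false] at hH' ⊢
  set q := u' / (2 - r') with hq
  have k4 : u' = q * (2 - r') := by rw [hq]; field_simp
  have k5 : u / (2 - r) * (2 - r) = u := by field_simp
  have e2 : (q - u / (2 - r)) * (2 - r) = (u' - u) + q * (r' - r) := by
    rw [sub_mul, k5, k4]; ring
  have e3 : |q - u / (2 - r)| ≤ |(q - u / (2 - r)) * (2 - r)| := by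
    rw [abs_mul, abs_of_pos (by linarith : 0 < 2 - r)]
    exact le_mul_of_one_le_right (abs_nonneg _) k0
  refine e3.trans ?_
  rw [e2]
  refine (abs_add_le _ _).trans ?_
  rw [abs_mul]
  nlinarith [abs_nonneg (r' - r)]

/-! ### The maps -/

section maps
variable {n : ℕ} [NeZero n]

def e0 (n : ℕ) [NeZero n] : Euc n := EuclideanSpace.single 0 1

def rr (y : Euc n) : ℝ := ‖y - y 0 • e0 n‖

theorem e0_zero : (e0 n) 0 = 1 := by simp [e0]

theorem e0_ne {i : Fin n} (hi : i ≠ 0) : (e0 n) i = 0 := by simp [e0, hi]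

theorem norm_e0 : ‖e0 n‖ = 1 := by simp [e0]

theorem rr_sq (y : Euc n) : (y 0) ^ 2 + rr y ^ 2 = ‖y‖ ^ 2 := by
  unfold rr
  rw [@norm_sub_sq_real, inner_smul_right, norm_smul, norm_e0]
  have : inner ℝ y (e0 n) = y 0 := by simp [e0, EuclideanSpace.inner_single_right]
  rw [this]; simp; ring

theorem rr_nonneg (y : Euc n) : 0 ≤ rr y := norm_nonneg _

theorem rr_add (y : Euc n) (c : ℝ) : rr (y + c • e0 n) = rr y := by
  unfold rr
  congr 1
  simp only [PiLp.add_apply, PiLp.smul_apply, e0_zero, smul_eq_mul, mul_one, add_smul]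
  abel

theorem add_zero' (y : Euc n) (c : ℝ) : (y + c • e0 n) 0 = y 0 + c := by
  simp [e0_zero]

theorem add_ne (y : Euc n) (c : ℝ) {i : Fin n} (hi : i ≠ 0) : (y + c • e0 n) i = y i := by
  simp [e0_ne hi]

theorem rr_le (y : Euc n) : rr y ≤ ‖y‖ := by
  apply le_of_sq_le_sq _ (norm_nonneg _)
  nlinarith [rr_sq y]

theorem coord_le (y : Euc n) (i : Fin n) : |y i| ≤ ‖y‖ := by
  simpa using PiLp.norm_apply_le y i

theorem rr_lip (x y : Euc n) : |rr x - rr y| ≤ ‖x - y‖ := by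
  refine le_trans ?_ (rr_le (x - y))
  unfold rr
  refine (abs_norm_sub_norm_le _ _).trans (le_of_eq ?_)
  congr 1
  simp only [PiLp.sub_apply, sub_smul]
  abel

theorem rr_eq_zero (y : Euc n) : rr y = 0 ↔ ∀ i : Fin n, i ≠ 0 → y i = 0 := by
  unfold rr
  rw [norm_eq_zero]
  constructor
  · intro h i hi
    have := congrArg (fun z : Euc n => z i) h
    simpa [e0_ne hi] using this
  · intro h
    ext i
    by_cases hi : i = 0
    · subst hi; simp [e0_zero]
    · simp [e0_ne hi, h i hi]

theorem norm_sub_e0 (y : Euc n) : ‖y - e0 n‖ ≤ rr y + |1 - y 0| := by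
  have : y - e0 n = (y - y 0 • e0 n) - (1 - y 0) • e0 n := by
    rw [sub_smul, one_smul]; abel
  rw [this]
  refine (norm_sub_le _ _).trans ?_
  rw [norm_smul, norm_e0, mul_one, Real.norm_eq_abs]
  rfl

/-- half length of the chord -/
def ss (y : Euc n) : ℝ := Real.sqrt (1 - rr y ^ 2)

theorem mem_ball_iff (y : Euc n) : y ∈ unitBall n ↔ rr y < 1 ∧ |y 0| < ss y := by
  unfold unitBall ss
  rw [mem_ball_zero_iff]
  have h := rr_sq y
  have h0 := rr_nonneg y
  have h1 := norm_nonneg y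
  rw [Real.lt_sqrt (abs_nonneg _), sq_abs]
  constructor
  · intro hy
    exact ⟨lt_of_le_of_lt (rr_le y) hy, by nlinarith⟩
  · rintro ⟨h2, h3⟩
    nlinarith

theorem ss_le (y : Euc n) : ss y ≤ 1 := Real.sqrt_le_one.mpr (by nlinarith [rr_nonneg y])

theorem mem_slit_iff {y : Euc n} (hy : y ∈ unitBall n) : y ∈ slit n ↔ 0 ≤ y 0 ∧ rr y = 0 := by
  rw [rr_eq_zero]
  have : y 0 < 1 := lt_of_lt_of_le (lt_of_le_of_lt (le_abs_self _) ((mem_ball_iff y).1 hy).2)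
    (ss_le y)
  simp only [slit, mem_setOf_eq]
  tauto

def psi (y : Euc n) : ℝ := ww (rr y) - (1 - rr y) * |y 0|

def gg (y : Euc n) : Euc n := y + psi y • e0 n

def uu (y : Euc n) : ℝ := y 0 - ww (rr y)

def hh (y : Euc n) : Euc n := y + (HH (uu y) (rr y) - y 0) • e0 n

theorem ww_rr (y : Euc n) : ww (rr y) = (1 - rr y) * ss y := rfl

theorem gg_mem {y : Euc n} (hy : y ∈ unitBall n \ slit n) : gg y ∈ unitBall n := by
  obtain ⟨hb, hs⟩ := hy
  rw [mem_slit_iff hb] at hs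
  rw [mem_ball_iff] at hb ⊢
  obtain ⟨h1, h2⟩ := hb
  have hss : ss (gg y) = ss y := by unfold ss gg; rw [rr_add]
  have hrr : rr (gg y) = rr y := by unfold gg; rw [rr_add]
  rw [hss, hrr]
  refine ⟨h1, ?_⟩
  unfold gg
  rw [add_zero', psi, ww_rr]
  have h0 := rr_nonneg y
  rw [abs_lt] at h2 ⊢
  rcases le_or_gt 0 (y 0) with h | h
  · have hr : 0 < rr y := lt_of_le_of_ne h0 fun e => hs ⟨h, e.symm⟩
    rw [abs_of_nonneg h]
    constructor <;> nlinarith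
  · rw [abs_of_neg h]
    constructor <;> nlinarith

theorem uu_bounds {y : Euc n} (hy : y ∈ unitBall n) :
    uu y < rr y * ss y ∧ -((2 - rr y) * ss y) < uu y := by
  obtain ⟨h1, h2⟩ := (mem_ball_iff y).1 hy
  rw [abs_lt] at h2
  unfold uu
  rw [ww_rr]
  constructor <;> nlinarith

theorem rr_pos {y : Euc n} (hy : y ∈ unitBall n) (hu : 0 ≤ uu y) : 0 < rr y := by
  have h := (uu_bounds hy).1
  refine lt_of_le_of_ne (rr_nonneg y) fun e => ?_
  rw [← e] at h; linarith

theorem HH_bounds {y : Euc n} (hy : y ∈ unitBall n) :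
    HH (uu y) (rr y) < ss y ∧ -ss y < HH (uu y) (rr y) ∧ |HH (uu y) (rr y)| ≤ 1 :=
  HH_bound (rr_nonneg y) ((mem_ball_iff y).1 hy).1.le (uu_bounds hy).1 (uu_bounds hy).2 (ss_le y)

theorem hh_zero (y : Euc n) : hh y 0 = HH (uu y) (rr y) := by
  unfold hh; rw [add_zero']; ring

theorem hh_mem {y : Euc n} (hy : y ∈ unitBall n) : hh y ∈ unitBall n \ slit n := by
  have hss : ss (hh y) = ss y := by unfold ss hh; rw [rr_add]
  have hrr : rr (hh y) = rr y := by unfold hh; rw [rr_add]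
  have hm : hh y ∈ unitBall n := by
    rw [mem_ball_iff, hss, hrr, hh_zero, abs_lt]
    exact ⟨((mem_ball_iff y).1 hy).1, (HH_bounds hy).2.1, (HH_bounds hy).1⟩
  refine ⟨hm, ?_⟩
  rw [mem_slit_iff hm, hrr, hh_zero]
  rintro ⟨h1, h2⟩
  by_cases hu : 0 ≤ uu y
  · exact (rr_pos hy hu).ne' h2
  · rw [HH, if_neg hu] at h1
    push Not at hu
    have : uu y / (2 - rr y) < 0 := div_neg_of_neg_of_pos hu (by rw [h2]; norm_num)
    linarith

theorem hh_gg {y : Euc n} (hy : y ∈ unitBall n \ slit n) : hh (gg y) = y := by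
  obtain ⟨hb, hs⟩ := hy
  rw [mem_slit_iff hb] at hs
  have h1 := ((mem_ball_iff y).1 hb).1
  have hrr : rr (gg y) = rr y := by unfold gg; rw [rr_add]
  have hu : uu (gg y) = y 0 - (1 - rr y) * |y 0| := by
    unfold uu; rw [hrr]; unfold gg; rw [add_zero', psi]; ring
  have key : HH (uu (gg y)) (rr (gg y)) = y 0 := by
    rw [hu, hrr]
    rcases le_or_gt 0 (y 0) with h | h
    · have hr : 0 < rr y := lt_of_le_of_ne (rr_nonneg y) fun e => hs ⟨h, e.symm⟩
      have e : y 0 - (1 - rr y) * |y 0| = rr y * y 0 := by rw [abs_of_nonneg h]; ring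
      rw [e, HH, if_pos (by positivity)]; field_simp
    · have e : y 0 - (1 - rr y) * |y 0| = (2 - rr y) * y 0 := by rw [abs_of_neg h]; ring
      have h2 : 0 < 2 - rr y := by linarith
      rw [e, HH, if_neg (not_le.2 (mul_neg_of_pos_of_neg h2 h))]; field_simp
  unfold hh
  rw [key]
  unfold gg
  rw [add_zero', add_assoc, ← add_smul]
  simp

theorem gg_hh {y : Euc n} (hy : y ∈ unitBall n) : gg (hh y) = y := by
  have h1 := ((mem_ball_iff y).1 hy).1
  have hrr : rr (hh y) = rr y := by unfold hh; rw [rr_add]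
  have key : psi (hh y) = y 0 - HH (uu y) (rr y) := by
    unfold psi
    rw [hrr, hh_zero]
    have hw : ww (rr y) = y 0 - uu y := by unfold uu; ring
    rw [hw]
    by_cases hu : 0 ≤ uu y
    · have hr := rr_pos hy hu
      rw [HH, if_pos hu, abs_of_nonneg (by positivity)]
      field_simp
      ring
    · rw [HH, if_neg hu]
      push Not at hu
      have h2 : 0 < 2 - rr y := by linarith
      rw [abs_of_neg (div_neg_of_neg_of_pos hu h2)]
      field_simp
      ring
  unfold gg
  rw [key]
  unfold hh
  rw [add_assoc, ← add_smul]
  simp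

theorem rr_le_one {y : Euc n} (hy : y ∈ unitBall n) : rr y ≤ 1 := ((mem_ball_iff y).1 hy).1.le

theorem gg_lip : LipschitzOnWith 6 (gg (n := n)) (unitBall n) := by
  refine LipschitzOnWith.of_dist_le_mul fun x hx y hy => ?_
  rw [dist_eq_norm, dist_eq_norm]
  have e : gg x - gg y = (x - y) + (psi x - psi y) • e0 n := by
    unfold gg; rw [sub_smul]; abel
  rw [e]
  refine (norm_add_le _ _).trans ?_
  rw [norm_smul, norm_e0, mul_one, Real.norm_eq_abs]
  have h1 := rr_lip x y
  have h2 := coord_le (x - y) 0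
  simp only [PiLp.sub_apply] at h2
  have h3 := ww_lip (rr_nonneg x) (rr_le_one hx) (rr_nonneg y) (rr_le_one hy)
  have h4 : |x 0| ≤ 1 := (((mem_ball_iff x).1 hx).2.le).trans (ss_le x)
  have h5 := abs_abs_sub_abs_le_abs_sub (x 0) (y 0)
  have e2 : psi x - psi y = (ww (rr x) - ww (rr y)) + (rr x - rr y) * |x 0|
      - (1 - rr y) * (|x 0| - |y 0|) := by
    unfold psi; ring
  have h6 : |psi x - psi y| ≤ 5 * ‖x - y‖ := by
    rw [e2]
    refine (abs_sub _ _).trans ((add_le_add_left (abs_add_le _ _) _).trans ?_)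
    rw [abs_mul, abs_mul, abs_abs]
    have k1 : |rr x - rr y| * |x 0| ≤ ‖x - y‖ := by
      nlinarith [abs_nonneg (rr x - rr y), abs_nonneg (x 0)]
    have k2 : |1 - rr y| ≤ 1 := abs_le.2 ⟨by linarith [rr_le_one hy], by linarith [rr_nonneg y]⟩
    have k3 : |1 - rr y| * |(|x 0| - |y 0|)| ≤ ‖x - y‖ := by
      nlinarith [abs_nonneg (|x 0| - |y 0|), abs_nonneg (1 - rr y)]
    linarith
  have : ((6 : ℝ≥0) : ℝ) = 6 := rfl
  rw [this]
  linarith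

theorem uu_lip {x y : Euc n} (hx : x ∈ unitBall n) (hy : y ∈ unitBall n) :
    |uu x - uu y| + |rr x - rr y| ≤ 5 * ‖x - y‖ := by
  have h1 := rr_lip x y
  have h2 := coord_le (x - y) 0
  simp only [PiLp.sub_apply] at h2
  have h3 := ww_lip (rr_nonneg x) (rr_le_one hx) (rr_nonneg y) (rr_le_one hy)
  have e : uu x - uu y = (x 0 - y 0) - (ww (rr x) - ww (rr y)) := by unfold uu; ring
  have := abs_sub (x 0 - y 0) (ww (rr x) - ww (rr y))
  rw [e]
  linarith

theorem sub_e0_pos {y : Euc n} (hy : y ∈ unitBall n) : 0 < ‖y - e0 n‖ := by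
  rw [norm_sub_pos_iff]
  rintro rfl
  simp [unitBall, norm_e0] at hy

theorem sub_e0_le {y : Euc n} (hy : y ∈ unitBall n) : ‖y - e0 n‖ ≤ 2 := by
  refine (norm_sub_le _ _).trans ?_
  rw [norm_e0]
  have : ‖y‖ < 1 := by simpa [unitBall] using hy
  linarith

theorem sub_e0_le_rr {y : Euc n} (hy : y ∈ unitBall n) (hu : 0 ≤ uu y) :
    ‖y - e0 n‖ ≤ 3 * rr y := by
  have h := norm_sub_e0 y
  obtain ⟨h1, h2⟩ := (mem_ball_iff y).1 hy
  have h0 := rr_nonneg y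
  have h3 : 1 - rr y ≤ ss y := Real.le_sqrt_of_sq_le (by nlinarith)
  unfold uu at hu
  rw [ww_rr] at hu
  have h4 := ss_le y
  rw [abs_lt] at h2
  rw [abs_of_nonneg (by linarith)] at h
  nlinarith

theorem hh0_lip {x y : Euc n} (hx : x ∈ unitBall n) (hy : y ∈ unitBall n)
    (h : 0 ≤ uu x ∨ (uu x < 0 ∧ uu y < 0)) :
    |hh y 0 - hh x 0| ≤ 15 * ‖x - e0 n‖⁻¹ * ‖y - x‖ := by
  rw [hh_zero, hh_zero]
  have hp := sub_e0_pos hx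
  have hd := norm_nonneg (y - x)
  have hu := uu_lip hy hx
  rcases h with h | ⟨h, h'⟩
  · have hr := rr_pos hx h
    have k := HH_lip_pos hr (rr_le_one hx) (rr_le_one hy) h (fun h' => rr_pos hy h')
      (HH_bounds hy).2.2
    refine k.trans ?_
    rw [div_le_iff₀ hr]
    refine hu.trans ?_
    have h3 := sub_e0_le_rr hx h
    have h4 : 1 ≤ ‖x - e0 n‖⁻¹ * (3 * rr x) := by
      rw [inv_mul_eq_div, one_le_div hp]; exact h3
    nlinarith
  · have k := HH_lip_neg (rr_le_one hx) (rr_le_one hy) h h' (HH_bounds hy).2.2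
    refine k.trans (hu.trans ?_)
    have h3 := sub_e0_le hx
    have h4 : 1 ≤ ‖x - e0 n‖⁻¹ * 2 := by
      rw [inv_mul_eq_div, one_le_div hp]; exact h3
    nlinarith

theorem hh_ne_lip {x : Euc n} (hx : x ∈ unitBall n) (y : Euc n) {i : Fin n} (hi : i ≠ 0) :
    |hh y i - hh x i| ≤ 15 * ‖x - e0 n‖⁻¹ * ‖y - x‖ := by
  unfold hh
  rw [add_ne _ _ hi, add_ne _ _ hi]
  have h2 := coord_le (y - x) i
  simp only [PiLp.sub_apply] at h2
  refine h2.trans ?_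
  have hp := sub_e0_pos hx
  have h3 := sub_e0_le hx
  have h4 : 1 ≤ ‖x - e0 n‖⁻¹ * 2 := by
    rw [inv_mul_eq_div, one_le_div hp]; exact h3
  nlinarith [norm_nonneg (y - x)]

theorem hh_lip_symm {x y : Euc n} (hx : x ∈ unitBall n) (hy : y ∈ unitBall n) (i : Fin n) :
    |hh y i - hh x i| ≤ 15 * ‖x - e0 n‖⁻¹ * ‖y - x‖ ∨
    |hh y i - hh x i| ≤ 15 * ‖y - e0 n‖⁻¹ * ‖y - x‖ := by
  by_cases hi : i = 0
  · subst hi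
    by_cases h : 0 ≤ uu x
    · exact Or.inl (hh0_lip hx hy (Or.inl h))
    · by_cases h' : 0 ≤ uu y
      · right
        rw [abs_sub_comm, norm_sub_rev y x]
        exact hh0_lip hy hx (Or.inl h')
      · exact Or.inl (hh0_lip hx hy (Or.inr ⟨not_le.1 h, not_le.1 h'⟩))
  · exact Or.inl (hh_ne_lip hx y hi)

theorem hh_lip_compact (i : Fin n) (K : Set (Euc n)) (hK : IsCompact K) (hKB : K ⊆ unitBall n) :
    ∃ L : ℝ≥0, LipschitzOnWith L (fun x => hh x i) K := by
  rcases K.eq_empty_or_nonempty with rfl | hne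
  · exact ⟨0, by simp⟩
  obtain ⟨z, hz, hmin⟩ := hK.exists_isMinOn (f := fun x => ‖x - e0 n‖) hne (by fun_prop)
  have hzp := sub_e0_pos (hKB hz)
  refine ⟨(15 * ‖z - e0 n‖⁻¹).toNNReal, LipschitzOnWith.of_dist_le_mul fun x hx y hy => ?_⟩
  rw [Real.coe_toNNReal _ (by positivity), Real.dist_eq, dist_eq_norm, abs_sub_comm,
    norm_sub_rev x y]
  have key : ∀ w ∈ K, 15 * ‖w - e0 n‖⁻¹ * ‖y - x‖ ≤ 15 * ‖z - e0 n‖⁻¹ * ‖y - x‖ := by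
    intro w hw
    have : ‖w - e0 n‖⁻¹ ≤ ‖z - e0 n‖⁻¹ := inv_anti₀ hzp (hmin hw)
    gcongr
  rcases hh_lip_symm (hKB hx) (hKB hy) i with h | h
  · exact h.trans (key x hx)
  · exact h.trans (key y hy)

theorem isOpen_unitBall : IsOpen (unitBall n) := isOpen_ball

theorem continuous_rr : Continuous (rr (n := n)) := by unfold rr; fun_prop

theorem continuous_uu : Continuous (uu (n := n)) := by
  have := continuous_rr (n := n)
  unfold uu ww; fun_prop

theorem hh_ev {x : Euc n} (hx : x ∈ unitBall n) (i : Fin n) :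
    ∀ᶠ y in nhds x, |hh y i - hh x i| ≤ 15 * ‖x - e0 n‖⁻¹ * ‖y - x‖ := by
  by_cases hi : i = 0
  · subst hi
    by_cases h : 0 ≤ uu x
    · filter_upwards [isOpen_unitBall.mem_nhds hx] with y hy
      exact hh0_lip hx hy (Or.inl h)
    · push Not at h
      filter_upwards [isOpen_unitBall.mem_nhds hx,
        continuous_uu.continuousAt.eventually (gt_mem_nhds h)] with y hy hy'
      exact hh0_lip hx hy (Or.inr ⟨h, hy'⟩)
  · exact Filter.Eventually.of_forall fun y => hh_ne_lip hx y hi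

theorem int_bound {p : ℝ} (hp0 : 0 ≤ p) (hp : p < n) :
    IntegrableOn (fun x : Euc n => (15 * ‖x - e0 n‖⁻¹) ^ p) (unitBall n) volume := by
  have hn : 1 ≤ n := Nat.one_le_iff_ne_zero.2 (NeZero.ne n)
  have h1 : LocallyIntegrable (fun x : Euc n => ‖x‖ ^ (-p)) volume := by
    refine locallyIntegrable_of_norm_le_rpow (C := 1) (α := p) (by simpa using hn)
      (by simpa using hp) (Filter.Eventually.of_forall fun x => ?_) ?_
    · rw [Real.norm_of_nonneg (by positivity), one_mul]
    · exact (measurable_norm.pow_const _).aestronglyMeasurable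
  have h2 : IntegrableOn (fun x : Euc n => ‖x‖ ^ (-p)) (closedBall (-e0 n) 1) volume :=
    h1.integrableOn_isCompact (isCompact_closedBall _ _)
  have h3 := (measurePreserving_sub_right (volume : Measure (Euc n)) (e0 n)).integrableOn_comp_preimage
    (measurableEmbedding_subRight (e0 n))
    (s := closedBall (-e0 n) 1) (f := fun x : Euc n => ‖x‖ ^ (-p))
  have h4 := h3.2 h2
  have h5 : IntegrableOn (fun x : Euc n => 15 ^ p * ‖x - e0 n‖ ^ (-p)) (unitBall n) volume := by
    refine (h4.mono_set ?_).const_mul _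
    intro x hx
    have : ‖x‖ < 1 := by simpa [unitBall] using hx
    simp [dist_eq_norm, this.le]
  refine h5.congr_fun (fun x _ => ?_) isOpen_unitBall.measurableSet
  simp only
  rw [Real.mul_rpow (by norm_num) (by positivity), Real.inv_rpow (norm_nonneg _),
    Real.rpow_neg (norm_nonneg _)]

theorem isOpen_dom : IsOpen (unitBall n \ slit n) := by
  have : unitBall n \ slit n = unitBall n \ {y | 0 ≤ y 0 ∧ rr y = 0} := by
    ext y
    simp only [mem_diff, mem_setOf_eq]
    constructor
    · rintro ⟨h, h'⟩; exact ⟨h, by rwa [mem_slit_iff h] at h'⟩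
    · rintro ⟨h, h'⟩; exact ⟨h, by rwa [mem_slit_iff h]⟩
  rw [this]
  refine isOpen_unitBall.sdiff ?_
  have := continuous_rr (n := n)
  have h0 : Continuous (fun y : Euc n => y 0) := by fun_prop
  exact (isClosed_le continuous_const h0).inter
    (isClosed_eq this continuous_const)

end maps

/-- For `n ≥ 3` there is a Lipschitz homeomorphism `g : 𝔹 ∖ I → 𝔹`
(in particular of finite conformal energy) whose inverse `h = g⁻¹` lies in `W^{1,p}(𝔹)` for
every `1 ≤ p < n`. -/
theorem stmt_6 {n : ℕ} [NeZero n] (hn : 3 ≤ n) :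
    ∃ g h : Euc n → Euc n,
      IsHomeoOn g h (unitBall n \ slit n) (unitBall n) ∧
      (∃ L : ℝ≥0, LipschitzOnWith L g (unitBall n \ slit n)) ∧
      (∃ Dg, MemSobolev (n : ℝ) (unitBall n \ slit n) g Dg) ∧
      ∀ p : ℝ, 1 ≤ p → p < (n : ℝ) →
        ∃ Dh, MemSobolev p (unitBall n) h Dh := by
  have hB := gg_lip (n := n)
  have hlip : LipschitzOnWith 6 (gg (n := n)) (unitBall n \ slit n) := hB.mono diff_subset
  have hcomp : ∀ i : Fin n, LipschitzOnWith 6 (fun x => gg (n := n) x i) (unitBall n \ slit n) := by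
    intro i
    refine LipschitzOnWith.of_dist_le_mul fun x hx y hy => ?_
    refine le_trans ?_ (hlip.dist_le_mul x hx y hy)
    rw [dist_eq_norm, dist_eq_norm]
    exact PiLp.norm_apply_le (gg x - gg y) i
  have hfin : volume (unitBall n \ slit n) ≠ ⊤ :=
    (lt_of_le_of_lt (measure_mono diff_subset) measure_ball_lt_top).ne
  have hcont : ContinuousOn (hh (n := n)) (unitBall n) := by
    have h1 : ContinuousOn (fun x : Euc n => WithLp.ofLp (hh x)) (unitBall n) :=
      continuousOn_pi.2 fun i => aux_cont isOpen_unitBall (hh_lip_compact i)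
    exact (PiLp.continuous_toLp 2 _).comp_continuousOn h1
  refine ⟨gg, hh, ⟨fun y hy => gg_mem hy, fun y hy => hh_mem hy, fun y hy => hh_gg hy,
    fun y hy => gg_hh hy, hlip.continuousOn, hcont⟩, ⟨6, hlip⟩, ?_, ?_⟩
  · refine memSobolev_of_lip isOpen_dom (fun i K _ hK => ⟨6, (hcomp i).mono hK⟩)
      (Nat.cast_nonneg n) (fun _ => 6) (fun _ => by norm_num) (fun x hx i => ?_)
      (integrableOn_const hfin)
    filter_upwards [isOpen_dom.mem_nhds hx] with y hy
    simpa using (hcomp i).norm_sub_le hy hx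
  · intro p hp1 hpn
    exact memSobolev_of_lip isOpen_unitBall hh_lip_compact (by linarith)
      (fun x => 15 * ‖x - e0 n‖⁻¹) (fun x => by positivity) (fun x hx i => hh_ev hx i)
      (int_bound (by linarith) hpn)
end
end

section
/- Let n ≥ 3 and let 𝔹_u be a model inward-cusp ball. Every homeomorphism h : 𝔹 → 𝔹_u of bi-conformal energy admits a homeomorphic extension to the closures; that is, there is a homeomorphism H : cl(𝔹) → cl(𝔹_u) with H = h on 𝔹. -/
open MeasureTheory Metric Set
open scoped ENNReal NNReal

noncomputable section

/-! ### Coordinates -/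

lemma le_of_sq_le {a b : ℝ} (h : a ^ 2 ≤ b ^ 2) (hb : 0 ≤ b) : a ≤ b := by
  by_contra! hc
  nlinarith

/-- The vector of `ℝ^{m+1}` with `i`-th coordinate `t` and the other ones given by `x`. -/
def insE {m : ℕ} (i : Fin (m + 1)) (t : ℝ) (x : Euc m) : Euc (m + 1) :=
  WithLp.toLp 2 (i.insertNth t (fun j => x j) : Fin (m + 1) → ℝ)

/-- The coordinates of a vector other than the `i`-th one. -/
def prp {m : ℕ} (i : Fin (m + 1)) (y : Euc (m + 1)) : Euc m :=
  WithLp.toLp 2 (fun j => y (i.succAbove j))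

lemma insE_self {m : ℕ} (i : Fin (m + 1)) (t : ℝ) (x : Euc m) : insE i t x i = t := by
  simp [insE]

lemma prp_insE {m : ℕ} (i : Fin (m + 1)) (t : ℝ) (x : Euc m) : prp i (insE i t x) = x := by
  ext j; simp [insE, prp]

lemma insE_prp {m : ℕ} (i : Fin (m + 1)) (y : Euc (m + 1)) : insE i (y i) (prp i y) = y := by
  ext j
  refine Fin.succAboveCases i ?_ ?_ j <;> simp [insE, prp]

lemma insE_add {m : ℕ} (i : Fin (m + 1)) (t s : ℝ) (x y : Euc m) :
    insE i (t + s) (x + y) = insE i t x + insE i s y := by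
  ext j
  refine Fin.succAboveCases i ?_ ?_ j <;> simp [insE]

lemma insE_smul {m : ℕ} (i : Fin (m + 1)) (t c : ℝ) (x : Euc m) :
    insE i (c * t) (c • x) = c • insE i t x := by
  ext j
  refine Fin.succAboveCases i ?_ ?_ j <;> simp [insE]

lemma prp_add {m : ℕ} (i : Fin (m + 1)) (x y : Euc (m + 1)) :
    prp i (x + y) = prp i x + prp i y := by ext j; simp [prp]

lemma prp_sub {m : ℕ} (i : Fin (m + 1)) (x y : Euc (m + 1)) :
    prp i (x - y) = prp i x - prp i y := by ext j; simp [prp]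

lemma prp_smul {m : ℕ} (i : Fin (m + 1)) (c : ℝ) (x : Euc (m + 1)) :
    prp i (c • x) = c • prp i x := by ext j; simp [prp]

lemma inner_split {m : ℕ} (i : Fin (m + 1)) (x y : Euc (m + 1)) :
    inner ℝ x y = x i * y i + inner ℝ (prp i x) (prp i y) := by
  simp only [PiLp.inner_apply, prp]
  rw [Fin.sum_univ_succAbove _ i]
  simp [mul_comm]

lemma norm_sq_split {m : ℕ} (i : Fin (m + 1)) (y : Euc (m + 1)) :
    ‖y‖ ^ 2 = (y i) ^ 2 + ‖prp i y‖ ^ 2 := by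
  rw [← real_inner_self_eq_norm_sq, ← real_inner_self_eq_norm_sq, inner_split i]; ring

lemma norm_prp_le {m : ℕ} (i : Fin (m + 1)) (y : Euc (m + 1)) : ‖prp i y‖ ≤ ‖y‖ := by
  have := norm_sq_split i y
  exact le_of_sq_le (by nlinarith [sq_nonneg (y i)]) (norm_nonneg _)

lemma abs_coord_le {m : ℕ} (i : Fin (m + 1)) (y : Euc (m + 1)) : |y i| ≤ ‖y‖ := by
  have := norm_sq_split i y
  exact abs_le_of_sq_le_sq' (by nlinarith [sq_nonneg ‖prp i y‖]) (norm_nonneg _) |> abs_le.2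

lemma norm_le_split {m : ℕ} (i : Fin (m + 1)) (y : Euc (m + 1)) : ‖y‖ ≤ |y i| + ‖prp i y‖ := by
  have := norm_sq_split i y
  have h2 : 0 ≤ |y i| := abs_nonneg _
  have h3 : 0 ≤ ‖prp i y‖ := norm_nonneg _
  exact le_of_sq_le (by nlinarith [sq_abs (y i)]) (by positivity)

lemma norm_insE_le {m : ℕ} (i : Fin (m + 1)) (t : ℝ) (x : Euc m) : ‖insE i t x‖ ≤ |t| + ‖x‖ := by
  simpa [insE_self, prp_insE] using norm_le_split i (insE i t x)

lemma continuous_insE {m : ℕ} (i : Fin (m + 1)) :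
    Continuous (fun q : ℝ × Euc m => insE i q.1 q.2) := by
  unfold insE
  refine (PiLp.continuous_toLp 2 _).comp ?_
  refine Continuous.finInsertNth i continuous_fst ?_
  fun_prop

lemma continuous_prp {m : ℕ} (i : Fin (m + 1)) : Continuous (prp i : Euc (m + 1) → Euc m) := by
  unfold prp
  refine (PiLp.continuous_toLp 2 _).comp ?_
  fun_prop

lemma measurePreserving_insE {m : ℕ} (i : Fin (m + 1)) :
    MeasurePreserving (fun q : ℝ × Euc m => insE i q.1 q.2) := by
  have h1 := (volume_preserving_piFinSuccAbove (fun _ : Fin (m + 1) => ℝ) i).symm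
  have h2 : MeasurePreserving (fun q : ℝ × Euc m => (q.1, (WithLp.ofLp q.2 : Fin m → ℝ))) :=
    (MeasurePreserving.id volume).prod (PiLp.volume_preserving_ofLp (Fin m))
  have h3 := (PiLp.volume_preserving_toLp (Fin (m + 1))).comp (h1.comp h2)
  convert! h3

/-- The point of the `r`-th slice over `x`. -/
def slc {m : ℕ} (i : Fin (m + 1)) (y0 : Euc (m + 1)) (σ k r : ℝ) (x : Euc m) : Euc (m + 1) :=
  y0 + insE i (σ * (-r + k * ‖x‖)) x

lemma continuous_slc {m : ℕ} (i : Fin (m + 1)) (y0 : Euc (m + 1)) (σ k : ℝ) :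
    Continuous (fun q : ℝ × Euc m => slc i y0 σ k q.1 q.2) := by
  unfold slc
  refine continuous_const.add ((continuous_insE i).comp (f := fun q : ℝ × Euc m =>
    (σ * (-q.1 + k * ‖q.2‖), q.2)) ?_)
  fun_prop

lemma lintegral_slc {m : ℕ} (i : Fin (m + 1)) (y0 : Euc (m + 1)) (σ k : ℝ) (hσ : σ = 1 ∨ σ = -1)
    (F : Euc (m + 1) → ℝ≥0∞) (hF : Measurable F) :
    ∫⁻ r : ℝ, ∫⁻ x : Euc m, F (slc i y0 σ k r x) = ∫⁻ y, F y := by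
  have hm : Measurable (fun q : ℝ × Euc m => F (slc i y0 σ k q.1 q.2)) :=
    hF.comp (continuous_slc i y0 σ k).measurable
  rw [lintegral_lintegral_swap hm.aemeasurable]
  have hG : Measurable (fun q : ℝ × Euc m => F (y0 + insE i q.1 q.2)) :=
    hF.comp (continuous_const.add (continuous_insE i)).measurable
  have key : ∀ x : Euc m, ∫⁻ r : ℝ, F (slc i y0 σ k r x) = ∫⁻ t : ℝ, F (y0 + insE i t x) := by
    intro x
    rcases hσ with rfl | rfl
    · rw [← lintegral_sub_left_eq_self (fun t => F (y0 + insE i t x)) (k * ‖x‖)]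
      refine lintegral_congr fun r => ?_
      simp only [slc]; congr 3; ring
    · rw [← lintegral_add_right_eq_self (fun t => F (y0 + insE i t x)) (-(k * ‖x‖))]
      refine lintegral_congr fun r => ?_
      simp only [slc]; congr 3; ring
  simp_rw [key]
  rw [lintegral_lintegral_swap]
  · rw [← lintegral_add_left_eq_self F y0,
      ← (measurePreserving_insE i).lintegral_comp (f := fun y => F (y0 + y)) (by fun_prop)]
    rw [Measure.volume_eq_prod, lintegral_prod _ hG.aemeasurable]
  · exact (hG.comp measurable_swap).aemeasurable

/-! ### Jensen / Morrey -/

lemma lintegral_pow_le {α : Type*} [MeasurableSpace α] (ν : Measure α) (m : ℕ) (f : α → ℝ≥0∞)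
    (hf : AEMeasurable f ν) :
    (∫⁻ a, f a ∂ν) ^ (m + 1) ≤ ν univ ^ m * ∫⁻ a, f a ^ (m + 1) ∂ν := by
  rcases Nat.eq_zero_or_pos m with rfl | hm
  · simp
  have hm' : (0 : ℝ) < m := by exact_mod_cast hm
  have hpq : ((m : ℝ) + 1).HolderConjugate (((m : ℝ) + 1) / m) := by
    rw [Real.holderConjugate_iff]
    refine ⟨by linarith, ?_⟩
    field_simp
    ring
  have h := ENNReal.lintegral_mul_le_Lp_mul_Lq ν hpq hf (aemeasurable_const (b := (1 : ℝ≥0∞)))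
  simp only [Pi.mul_apply, mul_one, ENNReal.one_rpow, lintegral_const, one_mul] at h
  have h2 := pow_le_pow_left' h (m + 1)
  rw [mul_pow, ← ENNReal.rpow_natCast, ← ENNReal.rpow_natCast, ← ENNReal.rpow_natCast,
    ← ENNReal.rpow_mul, ← ENNReal.rpow_mul] at h2
  have e1 : 1 / ((m : ℝ) + 1) * ((m + 1 : ℕ) : ℝ) = 1 := by push_cast; field_simp
  have e2 : 1 / (((m : ℝ) + 1) / m) * ((m + 1 : ℕ) : ℝ) = m := by push_cast; field_simp
  rw [e1, e2, ENNReal.rpow_one, ENNReal.rpow_natCast, ENNReal.rpow_natCast] at h2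
  rw [mul_comm]
  refine h2.trans (le_of_eq ?_)
  congr 1
  refine lintegral_congr fun a => ?_
  rw [← ENNReal.rpow_natCast]; push_cast; rfl

/-- The constant in the Morrey inequality. -/
def morC (m : ℕ) : ℝ≥0∞ := ∫⁻ s in Ioo (0 : ℝ) 1, ENNReal.ofReal s ^ (-((m : ℝ) / (m + 1)))

lemma morC_lt_top (m : ℕ) : morC m < ⊤ := by
  have h : IntegrableOn (fun s : ℝ => s ^ (-((m : ℝ) / (m + 1)))) (Ioo 0 1) := by
    rw [intervalIntegral.integrableOn_Ioo_rpow_iff zero_lt_one, neg_lt_neg_iff, div_lt_one (by positivity)]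
    linarith
  have h2 := h.lintegral_lt_top
  unfold morC
  refine lt_of_le_of_lt (le_of_eq ?_) h2
  refine setLIntegral_congr_fun measurableSet_Ioo fun s hs => ?_
  exact ENNReal.ofReal_rpow_of_pos hs.1

lemma lintegral_homothety {m : ℕ} (M : Euc m → ℝ≥0∞) (hM : Measurable M) (p : Euc m) (s : ℝ)
    (hs : 0 < s) : ∫⁻ z, M (p + s • (z - p)) = ENNReal.ofReal s ^ (-(m : ℝ)) * ∫⁻ z, M z := by
  have e1 := lintegral_sub_right_eq_self (fun z => M (p + s • z)) p (μ := volume)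
  rw [e1]
  have e2 : ∫⁻ x : Euc m, M (p + s • x) = ENNReal.ofReal |(s ^ Module.finrank ℝ (Euc m))⁻¹| *
      ∫⁻ x : Euc m, M (p + x) := by
    rw [← smul_eq_mul, ← lintegral_smul_measure, ← Measure.map_addHaar_smul _ hs.ne',
      lintegral_map (by fun_prop) (by fun_prop)]
  rw [e2, lintegral_add_left_eq_self]
  congr 1
  rw [finrank_euclideanSpace_fin, abs_of_pos (by positivity), ENNReal.ofReal_inv_of_pos (by positivity),
    ENNReal.ofReal_pow hs.le, ENNReal.rpow_neg, ENNReal.rpow_natCast]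

lemma morrey_one {m : ℕ} (M : Euc m → ℝ≥0∞) (hM : Measurable M) (B T : Set (Euc m))
    (hB : MeasurableSet B) (hTm : MeasurableSet T) (p : Euc m)
    (hT : ∀ z ∈ B, ∀ s ∈ Ioo (0 : ℝ) 1, p + s • (z - p) ∈ T) :
    ∫⁻ z in B, ∫⁻ s in Ioo (0 : ℝ) 1, M (p + s • (z - p)) ≤
      morC m * (volume B ^ m * ∫⁻ x in T, M x ^ (m + 1)) ^ ((1 : ℝ) / (m + 1)) := by
  have hmeas : Measurable (fun q : Euc m × ℝ => M (p + q.2 • (q.1 - p))) := by fun_prop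
  rw [lintegral_lintegral_swap hmeas.aemeasurable]
  set I := ∫⁻ x in T, M x ^ (m + 1) with hI
  have key : ∀ s ∈ Ioo (0 : ℝ) 1, ∫⁻ z in B, M (p + s • (z - p)) ≤
      ENNReal.ofReal s ^ (-((m : ℝ) / (m + 1))) * (volume B ^ m * I) ^ ((1 : ℝ) / (m + 1)) := by
    intro s hs
    have h1 := lintegral_pow_le (volume.restrict B) m (fun z => M (p + s • (z - p)))
      (by fun_prop)
    have h2 : ∫⁻ z in B, M (p + s • (z - p)) ^ (m + 1) ≤ ENNReal.ofReal s ^ (-(m : ℝ)) * I := by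
      rw [hI, ← lintegral_indicator hTm, ← lintegral_homothety _ ((hM.pow_const _).indicator hTm) p s hs.1,
        ← lintegral_indicator hB]
      refine lintegral_mono fun z => ?_
      by_cases hz : z ∈ B
      · simp [hz, hT z hz s hs]
      · simp [hz]
    have h3 : (∫⁻ z in B, M (p + s • (z - p))) ^ (m + 1) ≤
        ENNReal.ofReal s ^ (-(m : ℝ)) * (volume B ^ m * I) := by
      refine h1.trans ?_
      rw [Measure.restrict_apply_univ]
      calc _ ≤ volume B ^ m * (ENNReal.ofReal s ^ (-(m : ℝ)) * I) := by gcongr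
        _ = _ := by ring
    have h4 := ENNReal.rpow_le_rpow h3 (z := (1 : ℝ) / (m + 1)) (by positivity)
    rw [← ENNReal.rpow_natCast, ← ENNReal.rpow_mul,
      ENNReal.mul_rpow_of_nonneg _ _ (by positivity), ← ENNReal.rpow_mul] at h4
    have e1 : ((m + 1 : ℕ) : ℝ) * (1 / ((m : ℝ) + 1)) = 1 := by push_cast; field_simp
    have e2 : -(m : ℝ) * (1 / ((m : ℝ) + 1)) = -((m : ℝ) / (m + 1)) := by ring
    rwa [e1, e2, ENNReal.rpow_one] at h4
  calc _ ≤ ∫⁻ s in Ioo (0 : ℝ) 1, ENNReal.ofReal s ^ (-((m : ℝ) / (m + 1))) *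
        (volume B ^ m * I) ^ ((1 : ℝ) / (m + 1)) :=
        setLIntegral_mono (by fun_prop) key
    _ = _ := by rw [lintegral_mul_const _ (by fun_prop)]; rfl

lemma morrey_two {m : ℕ} (γ : Euc m → ℝ) (M : Euc m → ℝ≥0∞) (hM : Measurable M)
    (B T : Set (Euc m)) (hB : MeasurableSet B) (hBt : volume B ≠ ⊤) (hB0 : volume B ≠ 0)
    (hTm : MeasurableSet T) (p q : Euc m) (R : ℝ≥0∞)
    (hp : ∀ z ∈ B, ‖γ p - γ z‖ₑ ≤ R * ∫⁻ s in Ioo (0 : ℝ) 1, M (p + s • (z - p)))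
    (hq : ∀ z ∈ B, ‖γ q - γ z‖ₑ ≤ R * ∫⁻ s in Ioo (0 : ℝ) 1, M (q + s • (z - q)))
    (hpT : ∀ z ∈ B, ∀ s ∈ Ioo (0 : ℝ) 1, p + s • (z - p) ∈ T)
    (hqT : ∀ z ∈ B, ∀ s ∈ Ioo (0 : ℝ) 1, q + s • (z - q) ∈ T) :
    volume B * ‖γ p - γ q‖ₑ ^ (m + 1) ≤
      (2 * R * morC m) ^ (m + 1) * ∫⁻ x in T, M x ^ (m + 1) := by
  set I := ∫⁻ x in T, M x ^ (m + 1) with hI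
  have hmeas : ∀ p : Euc m, Measurable (fun z => ∫⁻ s in Ioo (0 : ℝ) 1, M (p + s • (z - p))) := by
    intro p
    exact Measurable.lintegral_prod_right' (f := fun q : Euc m × ℝ => M (p + q.2 • (q.1 - p)))
      (by fun_prop)
  have h1 : volume B * ‖γ p - γ q‖ₑ ≤
      2 * R * morC m * (volume B ^ m * I) ^ ((1 : ℝ) / (m + 1)) := by
    calc volume B * ‖γ p - γ q‖ₑ = ∫⁻ z in B, ‖γ p - γ q‖ₑ := by
          rw [setLIntegral_const, mul_comm]
      _ ≤ ∫⁻ z in B, (R * (∫⁻ s in Ioo (0 : ℝ) 1, M (p + s • (z - p))) +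
            R * ∫⁻ s in Ioo (0 : ℝ) 1, M (q + s • (z - q))) := by
          refine setLIntegral_mono (((hmeas p).const_mul R).add ((hmeas q).const_mul R))
            fun z hz => ?_
          have : γ p - γ q = (γ p - γ z) - (γ q - γ z) := by ring
          rw [this]
          exact (enorm_sub_le).trans (add_le_add (hp z hz) (hq z hz))
      _ = R * (∫⁻ z in B, ∫⁻ s in Ioo (0 : ℝ) 1, M (p + s • (z - p))) +
            R * ∫⁻ z in B, ∫⁻ s in Ioo (0 : ℝ) 1, M (q + s • (z - q)) := by
          rw [lintegral_add_left ((hmeas p).const_mul R), lintegral_const_mul _ (hmeas p),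
            lintegral_const_mul _ (hmeas q)]
      _ ≤ R * (morC m * (volume B ^ m * I) ^ ((1 : ℝ) / (m + 1))) +
            R * (morC m * (volume B ^ m * I) ^ ((1 : ℝ) / (m + 1))) := by
          gcongr
          · exact morrey_one M hM B T hB hTm p hpT
          · exact morrey_one M hM B T hB hTm q hqT
      _ = _ := by ring
  have h2 := pow_le_pow_left' h1 (m + 1)
  rw [mul_pow, mul_pow (2 * R * morC m), ← ENNReal.rpow_natCast ((volume B ^ m * I) ^ _),
    ← ENNReal.rpow_mul] at h2
  have e1 : (1 / ((m : ℝ) + 1)) * ((m + 1 : ℕ) : ℝ) = 1 := by push_cast; field_simp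
  rw [e1, ENNReal.rpow_one] at h2
  have h3 : volume B ^ m * (volume B * ‖γ p - γ q‖ₑ ^ (m + 1)) ≤
      volume B ^ m * ((2 * R * morC m) ^ (m + 1) * I) := by
    calc _ = volume B ^ (m + 1) * ‖γ p - γ q‖ₑ ^ (m + 1) := by ring
      _ ≤ _ := h2
      _ = _ := by ring
  exact (ENNReal.mul_le_mul_iff_right (pow_ne_zero _ hB0) (ENNReal.pow_ne_top hBt)).1 h3

/-! ### Integration along curves -/

lemma enorm_sub_le_curve {m : ℕ} (G : Euc (m + 1) → ℝ) (hG : ContDiff ℝ 1 G)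
    (c : ℝ → Euc (m + 1)) (K : ℝ≥0) (hc : LipschitzWith K c) (N : Set ℝ) (hN : N.Countable)
    (hd : ∀ s ∉ N, DifferentiableAt ℝ c s) :
    ‖G (c 0) - G (c 1)‖ₑ ≤ K * ∫⁻ s in Ioo (0 : ℝ) 1, ‖fderiv ℝ G (c s)‖ₑ := by
  have hGd : Differentiable ℝ G := hG.differentiable one_ne_zero
  have hcont : Continuous fun s => fderiv ℝ G (c s) :=
    (hG.continuous_fderiv one_ne_zero).comp hc.continuous
  set κ : ℝ → ℝ := fun s => G (c s) with hκ
  have hbd : ∀ s ∉ N, ‖deriv κ s‖ ≤ K * ‖fderiv ℝ G (c s)‖ := by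
    intro s hs
    have h1 : HasDerivAt κ (fderiv ℝ G (c s) (deriv c s)) s :=
      (hGd (c s)).hasFDerivAt.comp_hasDerivAt s (hd s hs).hasDerivAt
    rw [h1.deriv]
    have h2 : ‖deriv c s‖ ≤ K := norm_deriv_le_of_lipschitz hc
    calc _ ≤ ‖fderiv ℝ G (c s)‖ * ‖deriv c s‖ := ContinuousLinearMap.le_opNorm _ _
      _ ≤ ‖fderiv ℝ G (c s)‖ * K := by gcongr
      _ = _ := mul_comm _ _
  have hae : ∀ᵐ s : ℝ, s ∉ N := hN.ae_notMem volume
  have hintg : IntervalIntegrable (deriv κ) volume 0 1 := by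
    rw [intervalIntegrable_iff]
    refine Integrable.mono' (g := fun s => K * ‖fderiv ℝ G (c s)‖) ?_
      (measurable_deriv κ).aestronglyMeasurable ?_
    · have : Continuous fun s => (K : ℝ) * ‖fderiv ℝ G (c s)‖ := by fun_prop
      exact (intervalIntegrable_iff.1 (this.intervalIntegrable 0 1))
    · exact ae_restrict_of_ae (hae.mono hbd)
  have hftc : ∫ s in (0 : ℝ)..1, deriv κ s = κ 1 - κ 0 :=
    integral_eq_of_hasDerivAt_off_countable κ (deriv κ) hN
      (hG.continuous.comp hc.continuous).continuousOn
      (fun s hs => ((hGd (c s)).comp s (hd s hs.2)).hasDerivAt) hintg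
  have e : G (c 0) - G (c 1) = -(∫ s in (0 : ℝ)..1, deriv κ s) := by rw [hftc]; simp [hκ]
  rw [e, enorm_neg, intervalIntegral.integral_of_le zero_le_one, integral_Ioc_eq_integral_Ioo]
  refine (enorm_integral_le_lintegral_enorm _).trans ?_
  rw [← lintegral_const_mul' _ _ (by simp)]
  refine lintegral_mono_ae (ae_restrict_of_ae (hae.mono fun s hs => ?_))
  have := hbd s hs
  rw [← ofReal_norm, ← ofReal_norm (fderiv ℝ G (c s))]
  rw [← ENNReal.ofReal_coe_nnreal, ← ENNReal.ofReal_mul (by positivity)]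
  exact ENNReal.ofReal_le_ofReal this

/-- `insE` as a continuous linear map. -/
def insL {m : ℕ} (i : Fin (m + 1)) : (ℝ × Euc m) →L[ℝ] Euc (m + 1) :=
  LinearMap.toContinuousLinearMap
    { toFun := fun q => insE i q.1 q.2
      map_add' := fun _ _ => insE_add i _ _ _ _
      map_smul' := fun _ _ => insE_smul i _ _ _ }

lemma insE_sub {m : ℕ} (i : Fin (m + 1)) (t s : ℝ) (x y : Euc m) :
    insE i t x - insE i s y = insE i (t - s) (x - y) :=
  ((insL i).map_sub (t, x) (s, y)).symm

lemma slc_sub_le {m : ℕ} (i : Fin (m + 1)) (y0 : Euc (m + 1)) (σ k r : ℝ)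
    (hσ : σ = 1 ∨ σ = -1) (hk : 0 ≤ k) (x x' : Euc m) :
    ‖slc i y0 σ k r x - slc i y0 σ k r x'‖ ≤ (k + 1) * ‖x - x'‖ := by
  have e : slc i y0 σ k r x - slc i y0 σ k r x' = insE i (σ * (k * (‖x‖ - ‖x'‖))) (x - x') := by
    unfold slc
    rw [add_sub_add_left_eq_sub, insE_sub]; congr 1; ring
  rw [e]
  refine (norm_insE_le _ _ _).trans ?_
  have h1 : |σ| = 1 := by rcases hσ with rfl | rfl <;> simp
  rw [abs_mul, h1, abs_mul, abs_of_nonneg hk]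
  have := abs_norm_sub_norm_le x x'
  nlinarith

lemma slice_curve {m : ℕ} (i : Fin (m + 1)) (y0 : Euc (m + 1)) (σ k r : ℝ)
    (hσ : σ = 1 ∨ σ = -1) (hk : 0 ≤ k) (G : Euc (m + 1) → ℝ) (hG : ContDiff ℝ 1 G)
    (p z : Euc m) (A : ℝ) (hA : ‖z - p‖ ≤ A) :
    ‖G (slc i y0 σ k r p) - G (slc i y0 σ k r z)‖ₑ ≤ ENNReal.ofReal ((k + 1) * A) *
      ∫⁻ s in Ioo (0 : ℝ) 1, ‖fderiv ℝ G (slc i y0 σ k r (p + s • (z - p)))‖ₑ := by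
  by_cases hpz : z = p
  · simp [hpz]
  have hA0 : 0 ≤ A := (norm_nonneg _).trans hA
  have hzp : z - p ≠ 0 := sub_ne_zero.2 hpz
  have h := enorm_sub_le_curve G hG (fun s => slc i y0 σ k r (p + s • (z - p)))
    (Real.toNNReal ((k + 1) * A)) ?_ {s | p + s • (z - p) = 0} ?_ ?_
  · simpa [ENNReal.ofReal] using h
  · refine LipschitzWith.of_dist_le_mul fun s s' => ?_
    rw [dist_eq_norm, Real.coe_toNNReal _ (by positivity)]
    refine (slc_sub_le i y0 σ k r hσ hk _ _).trans ?_
    have : p + s • (z - p) - (p + s' • (z - p)) = (s - s') • (z - p) := by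
      rw [sub_smul]; abel
    rw [this, norm_smul, Real.dist_eq, Real.norm_eq_abs]
    have := abs_nonneg (s - s')
    calc (k + 1) * (|s - s'| * ‖z - p‖) ≤ (k + 1) * (|s - s'| * A) := by gcongr
      _ = _ := by ring
  · refine Set.Subsingleton.countable fun s hs s' hs' => ?_
    simp only [mem_ofPred_eq] at hs hs'
    have : (s - s') • (z - p) = 0 := by
      rw [sub_smul, ← add_sub_add_left_eq_sub _ _ p, hs, hs', sub_zero]
    rcases smul_eq_zero.1 this with h | h
    · linarith
    · exact absurd h hzp
  · intro s hs
    have h1 : DifferentiableAt ℝ (fun s : ℝ => p + s • (z - p)) s := by fun_prop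
    have h2 : DifferentiableAt ℝ (fun s : ℝ => ‖p + s • (z - p)‖) s := h1.norm ℝ hs
    have h3 : DifferentiableAt ℝ (fun s : ℝ =>
        ((σ * (-r + k * ‖p + s • (z - p)‖), p + s • (z - p)) : ℝ × Euc m)) s := by fun_prop
    have h4 := ((insL i).differentiableAt (x := (σ * (-r + k * ‖p + s • (z - p)‖),
      p + s • (z - p)))).comp s h3
    exact h4.const_add y0

/-! ### Mollification -/

lemma enorm_clm_le {n : ℕ} (L : Euc n →L[ℝ] ℝ) :
    ‖L‖ₑ ≤ ∑ k : Fin n, ‖L (EuclideanSpace.single k 1)‖ₑ := by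
  have h : ‖L‖ ≤ ∑ k : Fin n, ‖L (EuclideanSpace.single k 1)‖ := by
    refine L.opNorm_le_bound (by positivity) fun v => ?_
    have hv : v = ∑ k, v k • (EuclideanSpace.single k (1 : ℝ)) := by
      conv_lhs => rw [← (EuclideanSpace.basisFun (Fin n) ℝ).sum_repr v]
      simp
    conv_lhs => rw [hv]
    rw [map_sum, Finset.sum_mul]
    refine (norm_sum_le _ _).trans (Finset.sum_le_sum fun k _ => ?_)
    rw [map_smul, norm_smul, mul_comm]
    gcongr
    exact PiLp.norm_apply_le v k
  rw [← ofReal_norm]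
  refine (ENNReal.ofReal_le_ofReal h).trans ?_
  rw [ENNReal.ofReal_sum_of_nonneg (fun _ _ => norm_nonneg _)]
  exact le_of_eq (Finset.sum_congr rfl fun k _ => ofReal_norm _)

/-- `D` is the weak gradient of the scalar function `g` on `Ω`. -/
def WeakGrad {n : ℕ} (Ω : Set (Euc n)) (g : Euc n → ℝ) (D : Fin n → Euc n → ℝ) : Prop :=
  ∀ φ : Euc n → ℝ, ContDiff ℝ ((⊤ : ℕ∞) : WithTop ℕ∞) φ → HasCompactSupport φ →
    tsupport φ ⊆ Ω → ∀ j : Fin n,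
      ∫ x in Ω, g x * fderiv ℝ φ x (EuclideanSpace.single j 1) = - ∫ x in Ω, D j x * φ x

/-- The mollification of `g` on `Ω`. -/
def moll {n : ℕ} (Ω : Set (Euc n)) (g : Euc n → ℝ) (φ : ContDiffBump (0 : Euc n)) : Euc n → ℝ :=
  convolution (Ω.indicator g) (φ.normed volume) (ContinuousLinearMap.mul ℝ ℝ) volume

lemma moll_contDiff {n : ℕ} (Ω : Set (Euc n)) (hΩ : IsOpen Ω) (g : Euc n → ℝ)
    (hg : IntegrableOn g Ω) (φ : ContDiffBump (0 : Euc n)) : ContDiff ℝ 1 (moll Ω g φ) :=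
  φ.hasCompactSupport_normed.contDiff_convolution_right _
    (hg.integrable_indicator hΩ.measurableSet).locallyIntegrable φ.contDiff_normed

lemma moll_fderiv {n : ℕ} (Ω : Set (Euc n)) (hΩ : IsOpen Ω) (g : Euc n → ℝ)
    (hg : IntegrableOn g Ω) (φ : ContDiffBump (0 : Euc n)) (D : Fin n → Euc n → ℝ)
    (hD : WeakGrad Ω g D) (x : Euc n) (hx : closedBall x φ.rOut ⊆ Ω) (j : Fin n) :
    fderiv ℝ (moll Ω g φ) x (EuclideanSpace.single j 1) =
      ∫ y in Ω, D j y * φ.normed volume (x - y) := by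
  have hloc : LocallyIntegrable (Ω.indicator g) :=
    (hg.integrable_indicator hΩ.measurableSet).locallyIntegrable
  have h1 := (φ.hasCompactSupport_normed (μ := volume)).hasFDerivAt_convolution_right
    (μ := volume) (ContinuousLinearMap.mul ℝ ℝ) hloc (φ.contDiff_normed (μ := volume) (n := 1)) x
  have h1' : HasFDerivAt (moll Ω g φ) _ x := h1
  rw [h1'.fderiv, convolution_precompR_apply (μ := volume) _ hloc
    ((φ.hasCompactSupport_normed (μ := volume)).fderiv (𝕜 := ℝ))
    ((φ.contDiff_normed (μ := volume) (n := 1)).continuous_fderiv one_ne_zero)]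
  rw [convolution_def]
  have hψ : ContDiff ℝ ((⊤ : ℕ∞) : WithTop ℕ∞) (fun y => φ.normed volume (x - y)) :=
    φ.contDiff_normed.comp (contDiff_const.sub contDiff_id)
  have hts : tsupport (fun y => φ.normed volume (x - y)) ⊆ closedBall x φ.rOut := by
    refine closure_minimal (fun y hy => ?_) isClosed_closedBall
    have : x - y ∈ Function.support (φ.normed volume) := hy
    rw [φ.support_normed_eq, mem_ball_zero_iff] at this
    rw [mem_closedBall, dist_comm, dist_eq_norm]
    exact this.le
  have h2 := hD (fun y => φ.normed volume (x - y)) hψ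
    (HasCompactSupport.of_support_subset_isCompact (isCompact_closedBall x φ.rOut)
      ((subset_tsupport _).trans hts)) (hts.trans hx) j
  have h3 : ∀ y, fderiv ℝ (fun y => φ.normed volume (x - y)) y (EuclideanSpace.single j 1) =
      - fderiv ℝ (φ.normed volume) (x - y) (EuclideanSpace.single j 1) := by
    intro y
    have ha : HasFDerivAt (fun y : Euc n => x - y) (-(ContinuousLinearMap.id ℝ (Euc n))) y :=
      (hasFDerivAt_id y).const_sub x
    have hb := (((φ.contDiff_normed (n := 1) (μ := volume)).differentiable one_ne_zero)
      (x - y)).hasFDerivAt.comp y ha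
    have hb' : HasFDerivAt (fun y => φ.normed volume (x - y)) _ y := hb
    rw [hb'.fderiv]; simp
  simp_rw [h3, mul_neg, integral_neg, neg_inj] at h2
  rw [← h2, ← integral_indicator hΩ.measurableSet]
  refine integral_congr_ae (Filter.Eventually.of_forall fun y => ?_)
  by_cases hy : y ∈ Ω <;> simp [hy]

lemma lintegral_normed {n : ℕ} (φ : ContDiffBump (0 : Euc n)) :
    ∫⁻ y, ENNReal.ofReal (φ.normed volume y) = 1 := by
  rw [← ofReal_integral_eq_lintegral_ofReal φ.integrable_normed
    (Filter.Eventually.of_forall fun y => φ.nonneg_normed y), φ.integral_normed]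
  simp

lemma moll_partial_le {m : ℕ} (Ω : Set (Euc (m + 1))) (hΩ : IsOpen Ω) (g : Euc (m + 1) → ℝ)
    (hg : IntegrableOn g Ω) (φ : ContDiffBump (0 : Euc (m + 1))) (D : Fin (m + 1) → Euc (m + 1) → ℝ)
    (hDm : ∀ j, Measurable (D j))
    (hD : WeakGrad Ω g D) (O : Set (Euc (m + 1)))
    (hx : ∀ x ∈ O, closedBall x φ.rOut ⊆ Ω) (j : Fin (m + 1)) :
    ∫⁻ x in O, ‖fderiv ℝ (moll Ω g φ) x (EuclideanSpace.single j 1)‖ₑ ^ (m + 1) ≤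
      ∫⁻ y in Ω, ‖D j y‖ₑ ^ (m + 1) := by
  set w := φ.normed volume with hw
  have hwc : Continuous w := φ.continuous_normed
  have hmeas : Measurable fun q : Euc (m + 1) × Euc (m + 1) =>
      ENNReal.ofReal (w (q.1 - q.2)) * ‖D j q.2‖ₑ ^ (m + 1) := by
    have h1 : Measurable fun q : Euc (m + 1) × Euc (m + 1) => w (q.1 - q.2) :=
      (hwc.comp (continuous_fst.sub continuous_snd)).measurable
    have h2 : Measurable fun q : Euc (m + 1) × Euc (m + 1) => D j q.2 :=
      (hDm j).comp measurable_snd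
    fun_prop
  have key : ∀ x ∈ O, ‖fderiv ℝ (moll Ω g φ) x (EuclideanSpace.single j 1)‖ₑ ^ (m + 1) ≤
      ∫⁻ y in Ω, ENNReal.ofReal (w (x - y)) * ‖D j y‖ₑ ^ (m + 1) := by
    intro x hxO
    have hwx : Measurable fun y => ENNReal.ofReal (w (x - y)) :=
      (hwc.comp (continuous_const.sub continuous_id)).measurable.ennreal_ofReal
    rw [moll_fderiv Ω hΩ g hg φ D hD x (hx x hxO) j]
    set ν := (volume.restrict Ω).withDensity fun y => ENNReal.ofReal (w (x - y)) with hν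
    have h1 : ‖∫ y in Ω, D j y * w (x - y)‖ₑ ≤ ∫⁻ y, ‖D j y‖ₑ ∂ν := by
      refine (enorm_integral_le_lintegral_enorm _).trans ?_
      rw [hν, lintegral_withDensity_eq_lintegral_mul _ hwx (hDm j).enorm]
      refine lintegral_mono fun y => ?_
      simp only [Pi.mul_apply, enorm_mul]
      rw [mul_comm, ← ofReal_norm (w (x - y)), Real.norm_of_nonneg (φ.nonneg_normed _)]
    have h2 := lintegral_pow_le ν m (fun y => ‖D j y‖ₑ) (hDm j).enorm.aemeasurable
    have h3 : ν univ ≤ 1 := by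
      rw [hν, withDensity_apply _ MeasurableSet.univ, Measure.restrict_univ]
      refine (setLIntegral_le_lintegral _ _).trans ?_
      rw [lintegral_sub_left_eq_self (fun y => ENNReal.ofReal (w y)) x, lintegral_normed]
    calc _ ≤ (∫⁻ y, ‖D j y‖ₑ ∂ν) ^ (m + 1) := pow_le_pow_left' h1 _
      _ ≤ ν univ ^ m * ∫⁻ y, ‖D j y‖ₑ ^ (m + 1) ∂ν := h2
      _ ≤ 1 ^ m * ∫⁻ y, ‖D j y‖ₑ ^ (m + 1) ∂ν := by gcongr
      _ = _ := by
        rw [one_pow, one_mul, hν,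
          lintegral_withDensity_eq_lintegral_mul _ hwx ((hDm j).enorm.pow_const _)]
        rfl
  calc _ ≤ ∫⁻ x in O, ∫⁻ y in Ω, ENNReal.ofReal (w (x - y)) * ‖D j y‖ₑ ^ (m + 1) :=
        setLIntegral_mono (Measurable.lintegral_prod_right' hmeas) key
    _ ≤ ∫⁻ x, ∫⁻ y in Ω, ENNReal.ofReal (w (x - y)) * ‖D j y‖ₑ ^ (m + 1) :=
        setLIntegral_le_lintegral _ _
    _ = ∫⁻ y in Ω, ∫⁻ x, ENNReal.ofReal (w (x - y)) * ‖D j y‖ₑ ^ (m + 1) :=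
        lintegral_lintegral_swap hmeas.aemeasurable
    _ = _ := by
        refine lintegral_congr fun y => ?_
        have : Measurable fun x => ENNReal.ofReal (w (x - y)) :=
          (hwc.comp (continuous_id.sub continuous_const)).measurable.ennreal_ofReal
        rw [lintegral_mul_const _ this, lintegral_sub_right_eq_self
          (fun y => ENNReal.ofReal (w y)) y, lintegral_normed, one_mul]

lemma moll_energy {m : ℕ} (Ω : Set (Euc (m + 1))) (hΩ : IsOpen Ω) (g : Euc (m + 1) → ℝ)
    (hg : IntegrableOn g Ω) (φ : ContDiffBump (0 : Euc (m + 1))) (D : Fin (m + 1) → Euc (m + 1) → ℝ)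
    (hDm : ∀ j, Measurable (D j))
    (hD : WeakGrad Ω g D) (O : Set (Euc (m + 1)))
    (hx : ∀ x ∈ O, closedBall x φ.rOut ⊆ Ω) :
    ∫⁻ x in O, ‖fderiv ℝ (moll Ω g φ) x‖ₑ ^ (m + 1) ≤
      ((m : ℝ≥0∞) + 1) ^ m * ∑ j, ∫⁻ y in Ω, ‖D j y‖ₑ ^ (m + 1) := by
  have hcf : Continuous (fderiv ℝ (moll Ω g φ)) :=
    (moll_contDiff Ω hΩ g hg φ).continuous_fderiv one_ne_zero
  have h1 : ∀ x, ‖fderiv ℝ (moll Ω g φ) x‖ₑ ^ (m + 1) ≤ ((m : ℝ≥0∞) + 1) ^ m *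
      ∑ j, ‖fderiv ℝ (moll Ω g φ) x (EuclideanSpace.single j 1)‖ₑ ^ (m + 1) := by
    intro x
    refine (pow_le_pow_left' (enorm_clm_le _) _).trans ?_
    have := lintegral_pow_le (Measure.count : Measure (Fin (m + 1))) m
      (fun j => ‖fderiv ℝ (moll Ω g φ) x (EuclideanSpace.single j 1)‖ₑ)
      (measurable_of_finite _).aemeasurable
    simpa [lintegral_count, tsum_fintype, Measure.count_univ] using this
  have hm : ∀ j : Fin (m + 1), Measurable fun x =>
      ‖fderiv ℝ (moll Ω g φ) x (EuclideanSpace.single j 1)‖ₑ ^ (m + 1) := fun j =>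
    (hcf.clm_apply continuous_const).measurable.enorm.pow_const _
  calc _ ≤ ∫⁻ x in O, ((m : ℝ≥0∞) + 1) ^ m *
      ∑ j, ‖fderiv ℝ (moll Ω g φ) x (EuclideanSpace.single j 1)‖ₑ ^ (m + 1) :=
        lintegral_mono h1
    _ = ((m : ℝ≥0∞) + 1) ^ m * ∑ j, ∫⁻ x in O,
          ‖fderiv ℝ (moll Ω g φ) x (EuclideanSpace.single j 1)‖ₑ ^ (m + 1) := by
        rw [lintegral_const_mul _ (Finset.measurable_sum _ fun j _ => hm j),
          lintegral_finsetSum _ fun j _ => hm j]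
    _ ≤ _ := by
        exact mul_le_mul' le_rfl (Finset.sum_le_sum fun j _ =>
          moll_partial_le Ω hΩ g hg φ D hDm hD O hx j)

lemma moll_tendsto {n : ℕ} (Ω : Set (Euc n)) (hΩ : IsOpen Ω) (g : Euc n → ℝ)
    (hg : IntegrableOn g Ω) (hgc : ContinuousOn g Ω) (φ : ℕ → ContDiffBump (0 : Euc n))
    (hφ : Filter.Tendsto (fun j => (φ j).rOut) Filter.atTop (nhds 0)) (x : Euc n) (hx : x ∈ Ω) :
    Filter.Tendsto (fun j => moll Ω g (φ j) x) Filter.atTop (nhds (g x)) := by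
  have hc : ContinuousAt (Ω.indicator g) x := by
    have : Ω.indicator g =ᶠ[nhds x] g := by
      filter_upwards [hΩ.mem_nhds hx] with y hy using indicator_of_mem hy g
    exact (hgc.continuousAt (hΩ.mem_nhds hx)).congr this.symm
  have h := ContDiffBump.convolution_tendsto_right (μ := (volume : Measure (Euc n)))
    (g := fun _ : ℕ => Ω.indicator g) (k := fun _ => x) (x₀ := x) (z₀ := g x) hφ
    (Filter.Eventually.of_forall fun _ =>
      (hg.integrable_indicator hΩ.measurableSet).aestronglyMeasurable)
    (by
      have := hc.tendsto
      rw [indicator_of_mem hx] at this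
      exact this.comp Filter.tendsto_snd) tendsto_const_nhds
  refine h.congr fun j => ?_
  rw [convolution_eq_swap, moll, convolution_def]
  refine integral_congr_ae (Filter.Eventually.of_forall fun y => ?_)
  simp [mul_comm]

/-! ### The oscillation on slices -/

/-- The `r`-th slice of `Ω` is star-shaped from `p` towards a ball of radius `ρ r`. -/
def StarAt {m : ℕ} (Ω : Set (Euc (m + 1))) (i : Fin (m + 1)) (y0 : Euc (m + 1)) (σ k A ρ r : ℝ)
    (c p : Euc m) : Prop :=
  ∀ z ∈ closedBall c (ρ * r), ‖z - p‖ ≤ A * r ∧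
    ∀ s ∈ Icc (0 : ℝ) 1, slc i y0 σ k r (p + s • (z - p)) ∈ Ω

lemma exhaustion {n : ℕ} (Ω : Set (Euc n)) (hΩ : IsOpen Ω) (K : Set (Euc n)) (hK : IsCompact K)
    (hKΩ : K ⊆ Ω) (ε : ℕ → ℝ) (hε : Filter.Tendsto ε Filter.atTop (nhds 0)) :
    ∀ᶠ j in Filter.atTop, K ⊆ (cthickening (ε j) Ωᶜ)ᶜ := by
  obtain ⟨δ, hδ, hsub⟩ := hK.exists_cthickening_subset_open hΩ hKΩ
  filter_upwards [hε.eventually (gt_mem_nhds hδ)] with j hj x hx hxt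
  have h1 := cthickening_subset_thickening' hδ hj Ωᶜ hxt
  rw [mem_thickening_iff] at h1
  obtain ⟨y, hy, hxy⟩ := h1
  exact hy (hsub (mem_cthickening_of_dist_le y x δ K hx (by rw [dist_comm]; exact hxy.le)))

lemma slice_scalar {m : ℕ} (Ω : Set (Euc (m + 1))) (hΩ : IsOpen Ω) (g : Euc (m + 1) → ℝ)
    (hg : IntegrableOn g Ω) (hgc : ContinuousOn g Ω) (D : Fin (m + 1) → Euc (m + 1) → ℝ)
    (hDm : ∀ j, Measurable (D j)) (hD : WeakGrad Ω g D)
    (hE : ∀ j, ∫⁻ y in Ω, ‖D j y‖ₑ ^ (m + 1) < ⊤)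
    (i : Fin (m + 1)) (y0 : Euc (m + 1)) (σ k A ρ : ℝ)
    (hσ : σ = 1 ∨ σ = -1) (hk : 0 ≤ k) (hA : 0 ≤ A) (hρ : 0 < ρ) :
    ∃ Φ : ℝ → ℝ≥0∞, Measurable Φ ∧ ∫⁻ r, Φ r < ⊤ ∧ ∀ r > 0, ∀ c p q : Euc m,
      StarAt Ω i y0 σ k A ρ r c p → StarAt Ω i y0 σ k A ρ r c q →
      ‖g (slc i y0 σ k r p) - g (slc i y0 σ k r q)‖ₑ ^ (m + 1) * (ENNReal.ofReal r)⁻¹ ≤ Φ r := by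
  set ε : ℕ → ℝ := fun j => 1 / ((j : ℝ) + 1) with hε
  have hε0 : ∀ j, 0 < ε j := fun j => by positivity
  have hεt : Filter.Tendsto ε Filter.atTop (nhds 0) := tendsto_one_div_add_atTop_nhds_zero_nat
  let φ : ℕ → ContDiffBump (0 : Euc (m + 1)) := fun j =>
    ⟨ε j / 2, ε j, by have := hε0 j; positivity, by have := hε0 j; linarith⟩
  set O : ℕ → Set (Euc (m + 1)) := fun j => (cthickening (ε j) Ωᶜ)ᶜ with hO
  have hOo : ∀ j, IsOpen (O j) := fun j => isClosed_cthickening.isOpen_compl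
  have hOx : ∀ j, ∀ x ∈ O j, closedBall x (φ j).rOut ⊆ Ω := by
    intro j x hx y hy
    by_contra hc
    exact hx (mem_cthickening_of_dist_le x y (ε j) Ωᶜ hc (by rw [dist_comm]; exact hy))
  set G : ℕ → Euc (m + 1) → ℝ := fun j => moll Ω g (φ j) with hG
  have hGc : ∀ j, ContDiff ℝ 1 (G j) := fun j => moll_contDiff Ω hΩ g hg (φ j)
  have hGf : ∀ j, Continuous (fderiv ℝ (G j)) := fun j => (hGc j).continuous_fderiv one_ne_zero
  set F : ℕ → Euc (m + 1) → ℝ≥0∞ := fun j =>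
    (O j).indicator fun y => ‖fderiv ℝ (G j) y‖ₑ ^ (m + 1) with hF
  have hFm : ∀ j, Measurable (F j) := fun j =>
    ((hGf j).measurable.enorm.pow_const _).indicator (hOo j).measurableSet
  set E : ℝ≥0∞ := ((m : ℝ≥0∞) + 1) ^ m * ∑ j, ∫⁻ y in Ω, ‖D j y‖ₑ ^ (m + 1) with hEdef
  have hEt : E < ⊤ := by
    refine ENNReal.mul_lt_top (by finiteness) ?_
    exact ENNReal.sum_lt_top.2 fun j _ => hE j
  set v1 : ℝ≥0∞ := volume (ball (0 : Euc m) 1) with hv1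
  have hv1t : v1 ≠ ⊤ := measure_ball_lt_top.ne
  have hv10 : v1 ≠ 0 := (measure_ball_pos _ _ zero_lt_one).ne'
  set V : ℝ≥0∞ := ENNReal.ofReal ρ ^ m * v1 with hV
  have hVt : V ≠ ⊤ := by finiteness
  have hV0 : V ≠ 0 := mul_ne_zero (pow_ne_zero _ (by simpa using hρ)) hv10
  set C : ℝ≥0∞ := V⁻¹ * (2 * ENNReal.ofReal ((k + 1) * A) * morC m) ^ (m + 1) with hC
  have hmt := (morC_lt_top m).ne
  have hCt : C ≠ ⊤ := by
    refine ENNReal.mul_ne_top (by simpa using hV0) ?_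
    finiteness
  set P : ℕ → ℝ → ℝ≥0∞ := fun j r => C * ∫⁻ x : Euc m, F j (slc i y0 σ k r x) with hP
  have hPm : ∀ j, Measurable (P j) := fun j =>
    (Measurable.lintegral_prod_right' (f := fun q : ℝ × Euc m => F j (slc i y0 σ k q.1 q.2))
      ((hFm j).comp (continuous_slc i y0 σ k).measurable)).const_mul C
  refine ⟨fun r => Filter.liminf (fun j => P j r) Filter.atTop, .liminf hPm, ?_, ?_⟩
  · refine (lintegral_liminf_le hPm).trans_lt (lt_of_le_of_lt ?_
      (ENNReal.mul_lt_top hCt.lt_top hEt))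
    refine Filter.liminf_le_of_le (by isBoundedDefault) fun b hb => ?_
    obtain ⟨j, hj⟩ := hb.exists
    refine hj.trans ?_
    rw [hP, lintegral_const_mul' _ _ hCt, lintegral_slc i y0 σ k hσ _ (hFm j)]
    gcongr
    rw [hF, lintegral_indicator (hOo j).measurableSet]
    exact moll_energy Ω hΩ g hg (φ j) D hDm hD (O j) (hOx j)
  · intro r hr c p q hp hq
    have hr0 : ENNReal.ofReal r ≠ 0 := by simpa using hr
    have hball : (closedBall c (ρ * r)).Nonempty := ⟨c, mem_closedBall_self (by positivity)⟩
    obtain ⟨z0, hz0⟩ := hball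
    have hin : ∀ p, StarAt Ω i y0 σ k A ρ r c p → slc i y0 σ k r p ∈ Ω := by
      intro p hp
      simpa using (hp z0 hz0).2 0 (by simp)
    have hcomp : ∀ p, StarAt Ω i y0 σ k A ρ r c p → ∀ᶠ j in Filter.atTop,
        ∀ z ∈ closedBall c (ρ * r), ∀ s ∈ Ioo (0 : ℝ) 1,
          slc i y0 σ k r (p + s • (z - p)) ∈ O j := by
      intro p hp
      have hcont : Continuous fun q : Euc m × ℝ => slc i y0 σ k r (p + q.2 • (q.1 - p)) :=
        (continuous_slc i y0 σ k).comp (f := fun q : Euc m × ℝ => (r, p + q.2 • (q.1 - p)))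
          (by fun_prop)
      have hK := ((isCompact_closedBall c (ρ * r)).prod (isCompact_Icc (a := (0 : ℝ)) (b := 1))).image
        hcont
      have hKΩ : (fun q : Euc m × ℝ => slc i y0 σ k r (p + q.2 • (q.1 - p))) ''
          (closedBall c (ρ * r) ×ˢ Icc (0 : ℝ) 1) ⊆ Ω := by
        rintro _ ⟨⟨z, s⟩, ⟨hz, hs⟩, rfl⟩
        exact (hp z hz).2 s hs
      filter_upwards [exhaustion Ω hΩ _ hK hKΩ ε hεt] with j hj z hz s hs
      exact hj ⟨(z, s), ⟨hz, Ioo_subset_Icc_self hs⟩, rfl⟩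
    have hlim : Filter.Tendsto (fun j => ‖G j (slc i y0 σ k r p) - G j (slc i y0 σ k r q)‖ₑ ^ (m + 1)
        * (ENNReal.ofReal r)⁻¹) Filter.atTop
        (nhds (‖g (slc i y0 σ k r p) - g (slc i y0 σ k r q)‖ₑ ^ (m + 1) * (ENNReal.ofReal r)⁻¹)) := by
      refine ENNReal.Tendsto.mul_const ?_ (Or.inr (by simpa using hr))
      refine ENNReal.Tendsto.pow ?_
      exact ((moll_tendsto Ω hΩ g hg hgc φ hεt _ (hin p hp)).sub
        (moll_tendsto Ω hΩ g hg hgc φ hεt _ (hin q hq))).enorm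
    rw [← hlim.liminf_eq]
    refine Filter.liminf_le_liminf ?_
    filter_upwards [hcomp p hp, hcomp q hq] with j hjp hjq
    have hB : volume (closedBall c (ρ * r)) = V * ENNReal.ofReal r ^ m := by
      rw [Measure.addHaar_closedBall _ _ (by positivity), finrank_euclideanSpace_fin, mul_pow,
        ENNReal.ofReal_mul (by positivity), ENNReal.ofReal_pow hρ.le, ENNReal.ofReal_pow hr.le]
      ring
    have hT : MeasurableSet {x : Euc m | slc i y0 σ k r x ∈ O j} :=
      ((hOo j).preimage ((continuous_slc i y0 σ k).comp (f := fun x : Euc m => (r, x))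
        (by fun_prop))).measurableSet
    have hsc : Continuous fun x : Euc m => slc i y0 σ k r x :=
      (continuous_slc i y0 σ k).comp (f := fun x : Euc m => (r, x)) (by fun_prop)
    have hmor := morrey_two (fun x => G j (slc i y0 σ k r x))
      (fun x => ‖fderiv ℝ (G j) (slc i y0 σ k r x)‖ₑ)
      ((hGf j).comp hsc).measurable.enorm (closedBall c (ρ * r)) {x : Euc m | slc i y0 σ k r x ∈ O j}
      measurableSet_closedBall measure_closedBall_lt_top.ne
      (measure_closedBall_pos _ _ (by positivity)).ne' hT p q
      (ENNReal.ofReal ((k + 1) * (A * r)))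
      (fun z hz => slice_curve i y0 σ k r hσ hk (G j) (hGc j) p z _ (hp z hz).1)
      (fun z hz => slice_curve i y0 σ k r hσ hk (G j) (hGc j) q z _ (hq z hz).1) hjp hjq
    have hI : ∫⁻ x in {x : Euc m | slc i y0 σ k r x ∈ O j},
        ‖fderiv ℝ (G j) (slc i y0 σ k r x)‖ₑ ^ (m + 1) = ∫⁻ x : Euc m, F j (slc i y0 σ k r x) := by
      rw [← lintegral_indicator hT]
      refine lintegral_congr fun x => ?_
      by_cases hx : slc i y0 σ k r x ∈ O j <;> simp [hF, hx]
    rw [hI, hB] at hmor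
    have hRr : ENNReal.ofReal ((k + 1) * (A * r)) = ENNReal.ofReal ((k + 1) * A) * ENNReal.ofReal r := by
      rw [← ENNReal.ofReal_mul (by positivity)]; congr 1; ring
    rw [hRr] at hmor
    set X := ‖G j (slc i y0 σ k r p) - G j (slc i y0 σ k r q)‖ₑ ^ (m + 1) with hX
    set I := ∫⁻ x : Euc m, F j (slc i y0 σ k r x) with hIdef
    set a := ENNReal.ofReal r with ha
    have hat : a ≠ ⊤ := ENNReal.ofReal_ne_top
    have h5 : (V * a ^ (m + 1)) * (X * a⁻¹) ≤ (V * a ^ (m + 1)) * (C * I) := by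
      have e1 : (V * a ^ (m + 1)) * (X * a⁻¹) = V * a ^ m * X := by
        calc _ = V * a ^ m * X * (a * a⁻¹) := by ring
          _ = _ := by rw [ENNReal.mul_inv_cancel hr0 hat, mul_one]
      have e2 : (V * a ^ (m + 1)) * (C * I) =
          (2 * (ENNReal.ofReal ((k + 1) * A) * a) * morC m) ^ (m + 1) * I := by
        calc _ = (V * V⁻¹) * ((2 * (ENNReal.ofReal ((k + 1) * A) * a) * morC m) ^ (m + 1) * I) := by
              rw [hC]; ring
          _ = _ := by rw [ENNReal.mul_inv_cancel hV0 hVt, one_mul]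
      rw [e1, e2]; exact hmor
    exact (ENNReal.mul_le_mul_iff_right (mul_ne_zero hV0 (pow_ne_zero _ hr0))
      (ENNReal.mul_ne_top hVt (ENNReal.pow_ne_top hat))).1 h5

lemma abs_entry_le_opNorm {n : ℕ} (M : Matrix (Fin n) (Fin n) ℝ) (a j : Fin n) :
    |M a j| ≤ opNorm M := by
  have h1 := (LinearMap.toContinuousLinearMap (Matrix.toEuclideanLin M)).le_opNorm
    (EuclideanSpace.single j 1)
  have h2 : (LinearMap.toContinuousLinearMap (Matrix.toEuclideanLin M)
    (EuclideanSpace.single j (1 : ℝ))) a = M a j := by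
    simp [Matrix.toEuclideanLin, Matrix.toLpLin_apply]
  rw [← h2]
  refine (PiLp.norm_apply_le (LinearMap.toContinuousLinearMap (Matrix.toEuclideanLin M)
    (EuclideanSpace.single j (1 : ℝ))) a).trans (h1.trans ?_)
  simp [opNorm]

lemma slice_vec {m : ℕ} (Ω : Set (Euc (m + 1))) (hΩ : IsOpen Ω) (hΩb : volume Ω ≠ ⊤)
    (g : Euc (m + 1) → Euc (m + 1)) (hgc : ContinuousOn g Ω) (R : ℝ) (hgb : ∀ x ∈ Ω, ‖g x‖ ≤ R)
    (Dg : Euc (m + 1) → Matrix (Fin (m + 1)) (Fin (m + 1)) ℝ)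
    (hS : MemSobolev ((m + 1 : ℕ) : ℝ) Ω g Dg)
    (i : Fin (m + 1)) (y0 : Euc (m + 1)) (σ k A ρ : ℝ)
    (hσ : σ = 1 ∨ σ = -1) (hk : 0 ≤ k) (hA : 0 ≤ A) (hρ : 0 < ρ) :
    ∃ Φ : ℝ → ℝ≥0∞, Measurable Φ ∧ ∫⁻ r, Φ r < ⊤ ∧ ∀ r > 0, ∀ η > 0,
      ENNReal.ofReal r * Φ r ≤ ENNReal.ofReal (η ^ (m + 1)) → ∀ c p q : Euc m,
      StarAt Ω i y0 σ k A ρ r c p → StarAt Ω i y0 σ k A ρ r c q →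
      ‖g (slc i y0 σ k r p) - g (slc i y0 σ k r q)‖ ≤ (m + 1) * η := by
  have hcomp : ∀ a : Fin (m + 1), ∃ Φ : ℝ → ℝ≥0∞, Measurable Φ ∧ ∫⁻ r, Φ r < ⊤ ∧ ∀ r > 0,
      ∀ c p q : Euc m,
      StarAt Ω i y0 σ k A ρ r c p → StarAt Ω i y0 σ k A ρ r c q →
      ‖g (slc i y0 σ k r p) a - g (slc i y0 σ k r q) a‖ₑ ^ (m + 1) * (ENNReal.ofReal r)⁻¹
        ≤ Φ r := by
    intro a
    have hga : ContinuousOn (fun x => g x a) Ω := by fun_prop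
    have hgi : IntegrableOn (fun x => g x a) Ω := by
      refine IntegrableOn.of_bound hΩb.lt_top
        (hga.aestronglyMeasurable hΩ.measurableSet) R ?_
      filter_upwards [ae_restrict_mem hΩ.measurableSet] with x hx
      exact (PiLp.norm_apply_le (g x) a).trans (hgb x hx)
    have hDae : ∀ j, AEStronglyMeasurable (fun x => Dg x a j) (volume.restrict Ω) := fun j =>
      (hS.locIntD a j).aestronglyMeasurable
    set D : Fin (m + 1) → Euc (m + 1) → ℝ := fun j => (hDae j).mk _ with hD
    have hDe : ∀ j, (fun x => Dg x a j) =ᵐ[volume.restrict Ω] D j := fun j => (hDae j).ae_eq_mk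
    refine slice_scalar Ω hΩ (fun x => g x a) hgi hga D
      (fun j => (hDae j).stronglyMeasurable_mk.measurable) ?_ ?_ i y0 σ k A ρ hσ hk hA hρ
    · intro ψ h1 h2 h3 j
      rw [hS.parts ψ h1 h2 h3 a j]
      congr 1
      refine integral_congr_ae ?_
      filter_upwards [hDe j] with x hx
      simp only [hx]
    · intro j
      have h1 := hS.lp.2
      rw [HasFiniteIntegral] at h1
      refine lt_of_le_of_lt (lintegral_mono_ae ?_) h1
      filter_upwards [hDe j] with x hx
      rw [← hx, ← enorm_pow, Real.rpow_natCast]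
      rw [enorm_le_iff_norm_le]
      rw [norm_pow, norm_pow]
      refine pow_le_pow_left₀ (norm_nonneg _) ?_ _
      exact (abs_entry_le_opNorm _ _ _).trans (le_abs_self _)
  choose Φ hΦm hΦi hΦ using hcomp
  refine ⟨fun r => ∑ a, Φ a r, Finset.measurable_sum _ fun a _ => hΦm a, ?_, ?_⟩
  · rw [lintegral_finsetSum _ fun a _ => hΦm a]
    exact ENNReal.sum_lt_top.2 fun a _ => hΦi a
  · intro r hr η hη hle c p q hp hq
    have hr0 : ENNReal.ofReal r ≠ 0 := by simpa using hr
    have hco : ∀ a, ‖(g (slc i y0 σ k r p) - g (slc i y0 σ k r q)) a‖ ≤ η := by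
      intro a
      have h1 := hΦ a r hr c p q hp hq
      have h2 : Φ a r ≤ ∑ a, Φ a r := Finset.single_le_sum (f := fun a => Φ a r)
        (fun _ _ => zero_le) (Finset.mem_univ a)
      have h3 : ‖g (slc i y0 σ k r p) a - g (slc i y0 σ k r q) a‖ₑ ^ (m + 1) ≤
          ENNReal.ofReal (η ^ (m + 1)) := by
        refine le_trans ?_ hle
        calc _ = ENNReal.ofReal r * (‖g (slc i y0 σ k r p) a - g (slc i y0 σ k r q) a‖ₑ ^ (m + 1)
              * (ENNReal.ofReal r)⁻¹) := by
              rw [mul_comm, mul_assoc, ENNReal.inv_mul_cancel hr0 ENNReal.ofReal_ne_top, mul_one]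
          _ ≤ _ := by gcongr; exact h1.trans h2
      rw [← ofReal_norm, ← ENNReal.ofReal_pow (norm_nonneg _),
        ENNReal.ofReal_le_ofReal_iff (by positivity)] at h3
      exact (pow_le_pow_iff_left₀ (norm_nonneg _) hη.le (by omega)).1 h3
    have h4 : ‖g (slc i y0 σ k r p) - g (slc i y0 σ k r q)‖ ≤
        ∑ a, ‖(g (slc i y0 σ k r p) - g (slc i y0 σ k r q)) a‖ := by
      set v := g (slc i y0 σ k r p) - g (slc i y0 σ k r q)
      have hv : v = ∑ k, v k • (EuclideanSpace.single k (1 : ℝ)) := by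
        conv_lhs => rw [← (EuclideanSpace.basisFun (Fin (m + 1)) ℝ).sum_repr v]
        simp
      conv_lhs => rw [hv]
      refine (norm_sum_le _ _).trans (Finset.sum_le_sum fun k _ => ?_)
      simp [norm_smul]
    refine h4.trans ((Finset.sum_le_sum fun a _ => hco a).trans ?_)
    simp

lemma exists_good_radius (Φ : ℝ → ℝ≥0∞) (hΦi : ∫⁻ r, Φ r < ⊤) (ε η : ℝ)
    (hε : 0 < ε) (hη : 0 < η) :
    ∃ r, 0 < r ∧ r < ε ∧ ENNReal.ofReal r * Φ r ≤ ENNReal.ofReal η := by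
  by_contra! hc
  have h1 : ¬ IntegrableOn (fun r : ℝ => r ^ (-1 : ℝ)) (Ioo 0 ε) := by
    rw [intervalIntegral.integrableOn_Ioo_rpow_iff hε]; simp
  apply h1
  have h2 : IntegrableOn (fun r : ℝ => η * r ^ (-1 : ℝ)) (Ioo 0 ε) := by
    refine ⟨?_, ?_⟩
    · exact Measurable.aestronglyMeasurable (by fun_prop)
    · rw [HasFiniteIntegral]
      refine lt_of_le_of_lt ?_ (lt_of_le_of_lt (setLIntegral_le_lintegral (Ioo 0 ε) Φ) hΦi)
      refine lintegral_mono_ae ?_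
      filter_upwards [ae_restrict_mem measurableSet_Ioo] with r hr
      have h3 := (hc r hr.1 hr.2).le
      rw [Real.rpow_neg_one, Real.enorm_of_nonneg (mul_nonneg hη.le (inv_nonneg.2 hr.1.le)),
        ENNReal.ofReal_mul hη.le, ENNReal.ofReal_inv_of_pos hr.1, ← div_eq_mul_inv]
      exact ENNReal.div_le_of_le_mul' h3
  have h3 := h2.const_mul η⁻¹
  refine h3.congr (Filter.Eventually.of_forall fun r => ?_)
  field_simp

/-! ### Topology: small cuts force boundary limits -/

/-- `x0` can be cut off from `Ω` by sets that are small, and have small image under `φ`. -/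
def SmallCuts {n : ℕ} (Ω : Set (Euc n)) (φ : Euc n → Euc n) (x0 : Euc n) : Prop :=
  ∀ ε > 0, ∃ S U W : Set (Euc n), S ⊆ Ω ∧ S ⊆ closedBall x0 ε ∧
    (∀ s ∈ S, ∀ s' ∈ S, dist (φ s) (φ s') ≤ ε) ∧ U ∈ nhdsWithin x0 Ω ∧ U ⊆ closedBall x0 ε ∧
    IsOpen U ∧ IsOpen W ∧ Disjoint U W ∧ Ω \ S ⊆ U ∪ W

/-- Small sets do not separate points of `Y` from a base point. -/
def NoSep {n : ℕ} (Y : Set (Euc n)) : Prop :=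
  ∃ w ∈ Y, ∀ ε > 0, ∃ δ > 0, ∀ T : Set (Euc n), (∀ s ∈ T, ∀ s' ∈ T, dist s s' ≤ δ) →
    ∀ a ∈ Y, (∀ s ∈ T, ε ≤ dist a s ∧ ε ≤ dist w s) →
      ∃ C, IsPreconnected C ∧ C ⊆ Y \ T ∧ a ∈ C ∧ w ∈ C

lemma limit_exists {n : ℕ} (Ω Y : Set (Euc n)) (φ ψ : Euc n → Euc n) (h : IsHomeoOn φ ψ Ω Y)
    (x0 : Euc n) (hx0 : x0 ∈ closure Ω) (hx0' : x0 ∉ Ω) (hcut : SmallCuts Ω φ x0) (hY : NoSep Y) :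
    ∃ y, Filter.Tendsto φ (nhdsWithin x0 Ω) (nhds y) := by
  haveI : (nhdsWithin x0 Ω).NeBot := mem_closure_iff_nhdsWithin_neBot.1 hx0
  rw [← cauchy_map_iff_exists_tendsto, Metric.cauchy_iff]
  refine ⟨inferInstance, fun ε hε => ?_⟩
  obtain ⟨w, hw, hP⟩ := hY
  set d := dist (ψ w) x0 with hd
  have hd0 : 0 < d := dist_pos.2 fun e => hx0' (e ▸ h.mapsTo_inv hw)
  obtain ⟨εw, hεw, hw'⟩ := Metric.continuousOn_iff.1 h.continuousOn_inv w hw (d / 2) (by positivity)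
  obtain ⟨δ, hδ, hP⟩ := hP (min (ε / 8) εw) (by positivity)
  obtain ⟨S, U, W, hSΩ, hSb, hSd, hUn, hUb, hUo, hWo, hUW, hcov⟩ :=
    hcut (min (min δ (ε / 8)) (d / 4)) (by positivity)
  have hSw : ∀ s ∈ S, εw ≤ dist w (φ s) := by
    intro s hs
    by_contra! hc
    have h1 := hw' (φ s) (h.mapsTo (hSΩ hs)) (by rwa [dist_comm])
    rw [h.left_inv s (hSΩ hs)] at h1
    have h2 : dist s x0 ≤ d / 4 := (hSb hs).trans (min_le_right _ _)
    have h3 := dist_triangle (ψ w) s x0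
    rw [dist_comm (ψ w) s] at h3
    linarith
  have hkey : ∀ x ∈ U, x ∈ Ω → ∃ s ∈ S, dist (φ x) (φ s) < ε / 8 := by
    intro x hxU hxΩ
    by_contra! hc
    obtain ⟨C, hC, hCY, hxC, hwC⟩ := hP (φ '' S) (by
      rintro _ ⟨s, hs, rfl⟩ _ ⟨s', hs', rfl⟩
      exact (hSd s hs s' hs').trans ((min_le_left _ _).trans (min_le_left _ _)))
      (φ x) (h.mapsTo hxΩ) (by
      rintro _ ⟨s, hs, rfl⟩
      exact ⟨(min_le_left _ _).trans (hc s hs), (min_le_right _ _).trans (hSw s hs)⟩)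
    have hC' : IsPreconnected (ψ '' C) :=
      hC.image ψ (h.continuousOn_inv.mono fun y hy => (hCY hy).1)
    have hsub : ψ '' C ⊆ U := by
      refine IsPreconnected.subset_left_of_subset_union hUo hWo hUW ?_ ?_ hC'
      · rintro _ ⟨y, hy, rfl⟩
        refine hcov ⟨h.mapsTo_inv (hCY hy).1, fun hS => (hCY hy).2 ⟨ψ y, hS, ?_⟩⟩
        exact h.right_inv y (hCY hy).1
      · exact ⟨x, ⟨φ x, hxC, h.left_inv x hxΩ⟩, hxU⟩
    have h1 : dist (ψ w) x0 ≤ _ := hUb (hsub ⟨w, hwC, rfl⟩)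
    have h2 := h1.trans (min_le_right _ _)
    linarith
  refine ⟨φ '' (U ∩ Ω), Filter.image_mem_map (Filter.inter_mem hUn self_mem_nhdsWithin), ?_⟩
  rintro _ ⟨x, ⟨hx, hxΩ⟩, rfl⟩ _ ⟨y, ⟨hy, hyΩ⟩, rfl⟩
  obtain ⟨s, hs, h1⟩ := hkey x hx hxΩ
  obtain ⟨s', hs', h2⟩ := hkey y hy hyΩ
  have h3 : dist (φ s) (φ s') ≤ ε / 8 :=
    (hSd s hs s' hs').trans ((min_le_left _ _).trans (min_le_right _ _))
  have h4 := dist_triangle4 (φ x) (φ s) (φ s') (φ y)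
  rw [dist_comm (φ s') (φ y)] at h4
  linarith

lemma noSep_of_star {n : ℕ} (Y : Set (Euc n)) (w : Euc n) (hw : w ∈ Y)
    (hb : ∀ y ∈ Y, ‖y - w‖ ≤ 2)
    (H : ∀ a ∈ Y, ∃ v : Euc n, inner ℝ v (a - w) = 0 ∧ ‖v‖ = 1 / 2 ∧ segment ℝ a w ⊆ Y ∧
      segment ℝ a (w + v) ⊆ Y ∧ segment ℝ w (w + v) ⊆ Y) : NoSep Y := by
  refine ⟨w, hw, fun ε hε => ⟨ε / 6, by positivity, fun T hT a ha hTa => ?_⟩⟩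
  obtain ⟨v, hv, hvn, h1, h2, h3⟩ := H a ha
  by_cases hc : Disjoint (segment ℝ a w) T
  · exact ⟨segment ℝ a w, (convex_segment _ _).isPreconnected,
      subset_sdiff.2 ⟨h1, hc⟩, left_mem_segment _ _ _, right_mem_segment _ _ _⟩
  rw [Set.not_disjoint_iff] at hc
  obtain ⟨s1, hs1, hs1T⟩ := hc
  have hvv : inner ℝ v v = 1 / 4 := by rw [real_inner_self_eq_norm_sq, hvn]; norm_num
  rw [segment_symm, segment_eq_image'] at hs1
  obtain ⟨l, -, rfl⟩ := hs1
  -- the perpendicular component separates the two paths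
  have hperp : ∀ s2 ∈ T, ∀ μ : ℝ, inner ℝ v (s2 - w) = μ / 4 → μ ≤ ε / 3 := by
    intro s2 hs2 μ hμ
    have e1 : ‖s2 - (w + l • (a - w))‖ ≤ ε / 6 := by
      rw [← dist_eq_norm]; exact hT s2 hs2 _ hs1T
    have e2 := (abs_real_inner_le_norm v (s2 - (w + l • (a - w)))).trans
      (mul_le_mul_of_nonneg_left e1 (norm_nonneg v))
    rw [← sub_sub, inner_sub_right, inner_smul_right, hv, hμ, hvn] at e2
    have := le_abs_self (μ / 4 - l * 0)
    linarith
  refine ⟨segment ℝ a (w + v) ∪ segment ℝ w (w + v), ?_, ?_, Or.inl (left_mem_segment _ _ _),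
    Or.inr (left_mem_segment _ _ _)⟩
  · exact (convex_segment _ _).isPreconnected.union (w + v) (right_mem_segment _ _ _)
      (right_mem_segment _ _ _) (convex_segment _ _).isPreconnected
  · refine subset_sdiff.2 ⟨union_subset h2 h3, ?_⟩
    rw [Set.disjoint_left]
    rintro s2 (hs | hs) hs2
    · rw [segment_eq_image'] at hs
      obtain ⟨μ, hμ, rfl⟩ := hs
      have e1 := hperp _ hs2 μ (by
        have : a + μ • (w + v - a) - w = (1 - μ) • (a - w) + μ • v := by module
        rw [this, inner_add_right, inner_smul_right, inner_smul_right, hv, hvv]; ring)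
      have e2 := (hTa _ hs2).1
      rw [dist_eq_norm] at e2
      have e3 : ‖a - (a + μ • (w + v - a))‖ ≤ μ * (5 / 2) := by
        have : a - (a + μ • (w + v - a)) = μ • ((a - w) - v) := by module
        rw [this, norm_smul, Real.norm_of_nonneg hμ.1]
        refine mul_le_mul_of_nonneg_left ((norm_sub_le _ _).trans ?_) hμ.1
        have := hb a ha
        linarith
      linarith
    · rw [segment_eq_image'] at hs
      obtain ⟨μ, hμ, rfl⟩ := hs
      have e1 := hperp _ hs2 μ (by
        have : w + μ • (w + v - w) - w = μ • v := by module
        rw [this, inner_smul_right, hvv]; ring)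
      have e2 := (hTa _ hs2).2
      rw [dist_eq_norm] at e2
      have : w - (w + μ • (w + v - w)) = -(μ • v) := by module
      rw [this, norm_neg, norm_smul, Real.norm_of_nonneg hμ.1, hvn] at e2
      linarith

/-- Extension of a homeomorphism to closures, given boundary limits on both sides. -/
lemma extension_of_limits {n : ℕ} (Ω Y : Set (Euc n)) (φ ψ : Euc n → Euc n) (h : IsHomeoOn φ ψ Ω Y)
    (h1 : ∀ x ∈ closure Ω, x ∉ Ω → ∃ y, Filter.Tendsto φ (nhdsWithin x Ω) (nhds y))
    (h2 : ∀ y ∈ closure Y, y ∉ Y → ∃ x, Filter.Tendsto ψ (nhdsWithin y Y) (nhds x)) :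
    ∃ H G, IsHomeoOn H G (closure Ω) (closure Y) ∧ EqOn H φ Ω := by
  have key : ∀ (Ω Y : Set (Euc n)) (φ : Euc n → Euc n), MapsTo φ Ω Y → ContinuousOn φ Ω →
      (∀ x ∈ closure Ω, x ∉ Ω → ∃ y, Filter.Tendsto φ (nhdsWithin x Ω) (nhds y)) →
      ContinuousOn (extendFrom Ω φ) (closure Ω) ∧ EqOn (extendFrom Ω φ) φ Ω ∧
        MapsTo (extendFrom Ω φ) (closure Ω) (closure Y) := by
    intro Ω Y φ hm hc hl
    have hc' : ContinuousOn (extendFrom Ω φ) (closure Ω) := by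
      refine continuousOn_extendFrom subset_rfl fun x hx => ?_
      by_cases hxΩ : x ∈ Ω
      · exact ⟨φ x, hc x hxΩ⟩
      · exact hl x hx hxΩ
    have he : EqOn (extendFrom Ω φ) φ Ω := fun x hx =>
      extendFrom_eq (subset_closure hx) (hc x hx)
    refine ⟨hc', he, fun x hx => ?_⟩
    have := hc'.image_closure (mem_image_of_mem _ hx)
    refine closure_mono ?_ this
    rintro _ ⟨z, hz, rfl⟩
    rw [he hz]; exact hm hz
  obtain ⟨a1, a2, a3⟩ := key Ω Y φ h.mapsTo h.continuousOn h1
  obtain ⟨b1, b2, b3⟩ := key Y Ω ψ h.mapsTo_inv h.continuousOn_inv h2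
  refine ⟨extendFrom Ω φ, extendFrom Y ψ, ⟨a3, b3, ?_, ?_, a1, b1⟩, a2⟩
  · have := EqOn.of_subset_closure (s := Ω) (t := closure Ω)
      (f := fun x => extendFrom Y ψ (extendFrom Ω φ x)) (g := id) (fun x hx => by
        simp only [id]
        rw [a2 hx, b2 (h.mapsTo hx), h.left_inv x hx]) (b1.comp a1 a3) continuousOn_id
      subset_closure subset_rfl
    exact this
  · have := EqOn.of_subset_closure (s := Y) (t := closure Y)
      (f := fun x => extendFrom Ω φ (extendFrom Y ψ x)) (g := id) (fun x hx => by
        simp only [id]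
        rw [b2 hx, a2 (h.mapsTo_inv hx), h.right_inv x hx]) (a1.comp b1 b3) continuousOn_id
      subset_closure subset_rfl
    exact this

/-! ### Small cuts from a cone condition -/

/-- Near `y0`, the set `Ω` is stable under moving down in the cone of slope `K`. -/
def ConeCond {m : ℕ} (Ω : Set (Euc (m + 1))) (i : Fin (m + 1)) (y0 : Euc (m + 1))
    (σ K r0 : ℝ) : Prop :=
  ∀ y ∈ Ω, y ∈ ball y0 r0 → ∀ y' ∈ ball y0 r0,
    K * ‖prp i y' - prp i y‖ ≤ σ * (y i - y' i) → y' ∈ Ω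

lemma cone_below {m : ℕ} (Ω : Set (Euc (m + 1))) (i : Fin (m + 1)) (y0 : Euc (m + 1))
    (σ K r0 : ℝ) (hr0 : 0 < r0) (hy0 : y0 ∈ closure Ω) (hcone : ConeCond Ω i y0 σ K r0)
    (y' : Euc (m + 1)) (hy' : y' ∈ ball y0 r0)
    (h : K * ‖prp i y' - prp i y0‖ < σ * (y0 i - y' i)) : y' ∈ Ω := by
  have hc : Continuous fun y : Euc (m + 1) => K * ‖prp i y' - prp i y‖ :=
    continuous_const.mul (continuous_const.sub (continuous_prp i)).norm
  have hc2 : Continuous fun y : Euc (m + 1) => σ * (y i - y' i) := by fun_prop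
  have ho : IsOpen ({y | K * ‖prp i y' - prp i y‖ < σ * (y i - y' i)} ∩ ball y0 r0) :=
    (isOpen_lt hc hc2).inter isOpen_ball
  obtain ⟨y, ⟨hy1, hy2⟩, hyΩ⟩ := mem_closure_iff.1 hy0 _ ho ⟨h, mem_ball_self hr0⟩
  exact hcone y hyΩ hy2 y' hy' hy1.le

lemma prp_slc {m : ℕ} (i : Fin (m + 1)) (y0 : Euc (m + 1)) (σ k r : ℝ) (x : Euc m) :
    prp i (slc i y0 σ k r x) = prp i y0 + x := by
  rw [slc, prp_add, prp_insE]

lemma slc_coord {m : ℕ} (i : Fin (m + 1)) (y0 : Euc (m + 1)) (σ k r : ℝ) (x : Euc m) :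
    slc i y0 σ k r x i = y0 i + σ * (-r + k * ‖x‖) := by
  have := insE_self i (σ * (-r + k * ‖x‖)) x
  simp [slc, this]

lemma eq_slc {m : ℕ} (i : Fin (m + 1)) (y0 y : Euc (m + 1)) (σ k r : ℝ)
    (hσ : σ = 1 ∨ σ = -1)
    (h : σ * (y i - y0 i) = -r + k * ‖prp i y - prp i y0‖) :
    y = slc i y0 σ k r (prp i y - prp i y0) := by
  have hss : σ * σ = 1 := by rcases hσ with rfl | rfl <;> norm_num
  have e : σ * (-r + k * ‖prp i y - prp i y0‖) = (y - y0) i := by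
    rw [← h, ← mul_assoc, hss]; simp
  rw [slc, e, ← prp_sub, insE_prp]; abel

set_option maxHeartbeats 1000000 in
lemma cuts_of_cone {m : ℕ} (Ω : Set (Euc (m + 1))) (hΩ : IsOpen Ω) (hΩb : volume Ω ≠ ⊤)
    (g : Euc (m + 1) → Euc (m + 1)) (hgc : ContinuousOn g Ω) (R : ℝ) (hgb : ∀ x ∈ Ω, ‖g x‖ ≤ R)
    (Dg : Euc (m + 1) → Matrix (Fin (m + 1)) (Fin (m + 1)) ℝ)
    (hS : MemSobolev ((m + 1 : ℕ) : ℝ) Ω g Dg)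
    (y0 : Euc (m + 1)) (hy0 : y0 ∈ closure Ω) (hy0' : y0 ∉ Ω) (i : Fin (m + 1)) (σ K r0 : ℝ)
    (hσ : σ = 1 ∨ σ = -1) (hK : 1 ≤ K) (hr0 : 0 < r0) (hcone : ConeCond Ω i y0 σ K r0) :
    SmallCuts Ω g y0 := by
  have hK0 : 0 < K := by linarith
  have hσa : |σ| = 1 := by rcases hσ with rfl | rfl <;> norm_num
  obtain ⟨Φ, -, hΦi, hΦ⟩ := slice_vec Ω hΩ hΩb g hgc R hgb Dg hS i y0 σ (2 * K) (2 / K)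
    (1 / (18 * K)) hσ (by positivity) (by positivity) (by positivity)
  intro ε hε
  have hm : (0 : ℝ) < m + 1 := by positivity
  obtain ⟨r, hr, hrlt, hrΦ⟩ := exists_good_radius Φ hΦi (min (r0 / 2) (ε / 2))
    ((ε / (m + 1)) ^ (m + 1)) (by positivity) (by positivity)
  have hr1 : 2 * r < r0 := by have := hrlt.trans_le (min_le_left _ _); linarith
  have hr2 : 2 * r ≤ ε := by have := hrlt.trans_le (min_le_right _ _); linarith
  have hosc := hΦ r hr (ε / (m + 1)) (by positivity) hrΦ
  rw [mul_div_cancel₀ _ hm.ne'] at hosc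
  set T : Euc (m + 1) → ℝ := fun y => σ * (y i - y0 i) with hT
  set X : Euc (m + 1) → Euc m := fun y => prp i y - prp i y0 with hX
  have hTc : Continuous T := by simp only [hT]; fun_prop
  have hXc : Continuous X := (continuous_prp i).sub continuous_const
  have hQc : Continuous fun y => -r + 2 * K * ‖X y‖ :=
    continuous_const.add (continuous_const.mul hXc.norm)
  have hdist : ∀ y, dist y y0 ≤ |T y| + ‖X y‖ := by
    intro y
    have := norm_le_split i (y - y0)
    rw [dist_eq_norm]
    simp only [hT, hX, abs_mul, hσa, one_mul, ← prp_sub]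
    simpa using this
  have hKX : ∀ y ∈ Ω, y ∈ ball y0 r0 → T y < K * ‖X y‖ := by
    intro y hy hyb
    by_contra! hc
    refine hy0' (hcone y hy hyb y0 (mem_ball_self hr0) ?_)
    rw [norm_sub_rev]; exact hc
  have hfact : ∀ y ∈ Ω, y ∈ ball y0 r0 → -r + 2 * K * ‖X y‖ ≤ T y →
      K * ‖X y‖ < r ∧ ‖X y‖ ≤ r ∧ dist y y0 ≤ 2 * r := by
    intro y hy hyb hle
    have h1 := hKX y hy hyb
    have h2 : K * ‖X y‖ < r := by linarith
    have h3 : ‖X y‖ ≤ K * ‖X y‖ := le_mul_of_one_le_left (norm_nonneg _) hK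
    have h4 : |T y| ≤ r := abs_le.2 ⟨by linarith [norm_nonneg (X y)], by linarith⟩
    exact ⟨h2, by linarith, (hdist y).trans (by linarith)⟩
  refine ⟨{y | y ∈ Ω ∧ y ∈ ball y0 r0 ∧ T y = -r + 2 * K * ‖X y‖},
    Ω ∩ (ball y0 r0 ∩ {y | -r + 2 * K * ‖X y‖ < T y}),
    Ω ∩ ((closedBall y0 (2 * r))ᶜ ∪ {y | T y < -r + 2 * K * ‖X y‖}),
    fun y hy => hy.1, fun y hy => ?_, ?_, ?_, ?_, ?_, ?_, ?_, ?_⟩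
  · exact (hfact y hy.1 hy.2.1 hy.2.2.ge).2.2.trans hr2
  · have hstar : ∀ y ∈ Ω, y ∈ ball y0 r0 → T y = -r + 2 * K * ‖X y‖ →
        StarAt Ω i y0 σ (2 * K) (2 / K) (1 / (18 * K)) r 0 (X y) := by
      intro y hy hyb hTy z hz
      obtain ⟨h1, h2, h3⟩ := hfact y hy hyb hTy.ge
      rw [mem_closedBall, dist_zero_right] at hz
      have hz' : K * ‖z‖ ≤ r / 18 := by
        calc K * ‖z‖ ≤ K * (1 / (18 * K) * r) := by gcongr
          _ = r / 18 := by field_simp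
      refine ⟨?_, fun s hs => ?_⟩
      · refine (norm_sub_le _ _).trans ?_
        rw [div_mul_eq_mul_div, le_div_iff₀ hK0]
        nlinarith
      · set p := X y with hp
        set p' := p + s • (z - p) with hp'
        have hn1 : ‖p'‖ ≤ (1 - s) * ‖p‖ + s * ‖z‖ := by
          have : p' = (1 - s) • p + s • z := by rw [hp']; module
          rw [this]
          refine (norm_add_le _ _).trans ?_
          rw [norm_smul, norm_smul, Real.norm_of_nonneg hs.1, Real.norm_of_nonneg (sub_nonneg.2 hs.2)]
        have hn2 : ‖p' - p‖ ≤ s * (‖p‖ + ‖z‖) := by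
          have : p' - p = s • (z - p) := by rw [hp']; module
          rw [this, norm_smul, Real.norm_of_nonneg hs.1]
          refine mul_le_mul_of_nonneg_left ((norm_sub_le _ _).trans (by linarith)) hs.1
        set y' := slc i y0 σ (2 * K) r p' with hy'
        have hXy' : prp i y' = prp i y0 + p' := prp_slc _ _ _ _ _ _
        have hss : σ * σ = 1 := by rcases hσ with rfl | rfl <;> norm_num
        have hTy' : σ * (y' i - y0 i) = -r + 2 * K * ‖p'‖ := by
          rw [hy', slc_coord, add_sub_cancel_left, ← mul_assoc, hss, one_mul]
        have e4 : K * ‖p'‖ ≤ (1 - s) * (K * ‖p‖) + s * (K * ‖z‖) :=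
          (mul_le_mul_of_nonneg_left hn1 hK0.le).trans_eq (by ring)
        have hKp' : K * ‖p'‖ ≤ r := by
          have f1 : (1 - s) * (K * ‖p‖) ≤ (1 - s) * r :=
            mul_le_mul_of_nonneg_left h1.le (sub_nonneg.2 hs.2)
          have f2 : s * (K * ‖z‖) ≤ s * r := mul_le_mul_of_nonneg_left (by linarith) hs.1
          linarith
        have hp'r : ‖p'‖ ≤ K * ‖p'‖ := le_mul_of_one_le_left (norm_nonneg _) hK
        have hb' : y' ∈ ball y0 r0 := by
          rw [mem_ball]
          refine lt_of_le_of_lt (hdist y') ?_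
          have e1 : T y' = -r + 2 * K * ‖p'‖ := hTy'
          have e2 : X y' = p' := by simp only [hX]; rw [hXy']; abel
          rw [e1, e2]
          have : |(-r + 2 * K * ‖p'‖)| ≤ r :=
            abs_le.2 ⟨by linarith [norm_nonneg p'], by linarith⟩
          linarith
        by_cases hc : r / 6 ≤ K * ‖p‖
        · refine hcone y hy hyb y' hb' ?_
          have e1 : prp i y' - prp i y = p' - p := by
            rw [hXy', hp]; simp only [hX]; abel
          have e2 : σ * (y i - y' i) = T y - σ * (y' i - y0 i) := by simp only [hT]; ring
          rw [e1, e2, hTy, hTy']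
          have e3 : K * ‖p' - p‖ ≤ s * (K * ‖p‖ + K * ‖z‖) :=
            (mul_le_mul_of_nonneg_left hn2 hK0.le).trans_eq (by ring)
          have e5 : 0 ≤ s * (K * ‖p‖ - 3 * (K * ‖z‖)) := mul_nonneg hs.1 (by linarith)
          linarith
        · push Not at hc
          refine cone_below Ω i y0 σ K r0 hr0 hy0 hcone y' hb' ?_
          have e1 : prp i y' - prp i y0 = p' := by rw [hXy']; abel
          have e2 : σ * (y0 i - y' i) = -(σ * (y' i - y0 i)) := by ring
          rw [e1, e2, hTy']
          have e5 : (1 - s) * (K * ‖p‖) ≤ (1 - s) * (r / 6) :=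
            mul_le_mul_of_nonneg_left hc.le (sub_nonneg.2 hs.2)
          have e6 : s * (K * ‖z‖) ≤ s * (r / 6) :=
            mul_le_mul_of_nonneg_left (by linarith) hs.1
          linarith
    intro y hy y' hy'
    have := hosc 0 (X y) (X y') (hstar y hy.1 hy.2.1 hy.2.2) (hstar y' hy'.1 hy'.2.1 hy'.2.2)
    rw [← eq_slc i y0 y σ _ r hσ hy.2.2, ← eq_slc i y0 y' σ _ r hσ hy'.2.2] at this
    rwa [dist_eq_norm]
  · refine Filter.inter_mem self_mem_nhdsWithin (mem_nhdsWithin_of_mem_nhds ?_)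
    refine Filter.inter_mem (ball_mem_nhds _ hr0) ((isOpen_lt hQc hTc).mem_nhds ?_)
    simp [hT, hX, hr]
  · exact fun y hy => (hfact y hy.1 hy.2.1 (le_of_lt hy.2.2)).2.2.trans hr2
  · exact hΩ.inter (isOpen_ball.inter (isOpen_lt hQc hTc))
  · exact hΩ.inter (isClosed_closedBall.isOpen_compl.union (isOpen_lt hTc hQc))
  · rw [Set.disjoint_left]
    rintro y ⟨hy, hyb, hlt⟩ ⟨-, h | h⟩
    · exact h (hfact y hy hyb (le_of_lt hlt)).2.2
    · exact lt_asymm (show T y < -r + 2 * K * ‖X y‖ from h) hlt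
  · rintro y ⟨hy, hyS⟩
    by_cases hyb : y ∈ ball y0 r0
    · rcases lt_trichotomy (T y) (-r + 2 * K * ‖X y‖) with h | h | h
      · exact Or.inr ⟨hy, Or.inr h⟩
      · exact absurd ⟨hy, hyb, h⟩ hyS
      · exact Or.inl ⟨hy, hyb, h⟩
    · refine Or.inr ⟨hy, Or.inl fun h => hyb ?_⟩
      exact lt_of_le_of_lt h hr1

/-! ### The cusp ball and its tip -/

lemma cusp_zero {u : ℝ → ℝ} (hu : IsModelCusp u) : u 0 = 0 := by
  obtain ⟨s, hs, hs0⟩ := hu.surjOn (mem_Ici.2 (le_refl (0 : ℝ)))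
  have h1 : (0 : ℝ) ≤ u 0 := hu.mapsTo (mem_Ici.2 le_rfl)
  have h2 := hu.strictMonoOn.monotoneOn (mem_Ici.2 le_rfl) hs hs
  linarith

lemma cusp_convex {u : ℝ → ℝ} (hu : IsModelCusp u) : ConvexOn ℝ (Ici 0) u := by
  refine MonotoneOn.convexOn_of_deriv (convex_Ici 0) hu.continuousOn ?_ ?_
  · rw [interior_Ici]
    exact hu.contDiffOn.differentiableOn one_ne_zero
  · rw [interior_Ici]; exact hu.deriv_mono

lemma cusp_smul_le {u : ℝ → ℝ} (hu : IsModelCusp u) {l t : ℝ} (hl : 0 ≤ l) (hl1 : l ≤ 1)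
    (ht : 0 ≤ t) : u (l * t) ≤ l * u t := by
  have := (cusp_convex hu).2 (mem_Ici.2 ht) (mem_Ici.2 (le_refl (0 : ℝ))) hl (sub_nonneg.2 hl1)
    (by ring)
  simpa [cusp_zero hu] using this

lemma cusp_le_self {u : ℝ → ℝ} (hu : IsModelCusp u) {t : ℝ} (ht : 0 ≤ t) (ht1 : t ≤ 1) :
    u t ≤ t := by
  have := cusp_smul_le hu ht ht1 zero_le_one
  simpa [hu.one] using this

lemma norm_prp_zero {m : ℕ} (p : Euc (m + 1)) :
    Real.sqrt (∑ i ∈ Finset.univ.erase (0 : Fin (m + 1)), p i ^ 2) = ‖prp 0 p‖ := by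
  have h1 := norm_sq_split 0 p
  rw [EuclideanSpace.norm_sq_eq, ← Finset.add_sum_erase _ _ (Finset.mem_univ (0 : Fin (m + 1)))] at h1
  simp only [Real.norm_eq_abs, sq_abs] at h1
  have h2 : ∑ i ∈ Finset.univ.erase (0 : Fin (m + 1)), p i ^ 2 = ‖prp 0 p‖ ^ 2 := by linarith
  rw [h2, Real.sqrt_sq (norm_nonneg _)]

lemma mem_cusp {m : ℕ} {u : ℝ → ℝ} {y : Euc (m + 1)} :
    y ∈ cuspBall (m + 1) u ↔ ‖y‖ < 1 ∧ (0 ≤ y 0 → u (y 0) < ‖prp 0 y‖) := by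
  rw [cuspBall, mem_sdiff, mem_ball, dist_zero_right, mem_ofPred_eq, norm_prp_zero]
  simp only [not_and, not_le]

lemma closed_cusp {m : ℕ} {u : ℝ → ℝ} (hu : IsModelCusp u) :
    IsClosed {y : Euc (m + 1) | 0 ≤ y 0 ∧ ‖prp 0 y‖ ≤ u (y 0)} := by
  have h1 : {y : Euc (m + 1) | 0 ≤ y 0 ∧ ‖prp 0 y‖ ≤ u (y 0)} =
      {y | 0 ≤ y 0} ∩ {y | ‖prp 0 y‖ ≤ u (max (y 0) 0)} := by
    ext y
    simp only [mem_ofPred_eq, mem_inter_iff]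
    refine and_congr_right fun h => ?_
    rw [max_eq_left h]
  have hc : Continuous fun y : Euc (m + 1) => u (max (y 0) 0) :=
    hu.continuousOn.comp_continuous (by fun_prop) fun y => mem_Ici.2 (le_max_right _ _)
  rw [h1]
  exact (isClosed_le continuous_const (by fun_prop)).inter
    (isClosed_le (continuous_prp 0).norm hc)

lemma cusp_eq {m : ℕ} {u : ℝ → ℝ} : cuspBall (m + 1) u =
    ball 0 1 ∩ {y : Euc (m + 1) | 0 ≤ y 0 ∧ ‖prp 0 y‖ ≤ u (y 0)}ᶜ := by
  ext y
  rw [mem_cusp]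
  simp

lemma isOpen_cusp {m : ℕ} {u : ℝ → ℝ} (hu : IsModelCusp u) : IsOpen (cuspBall (m + 1) u) := by
  rw [cusp_eq]
  exact isOpen_ball.inter (closed_cusp hu).isOpen_compl

lemma tip_norm {m : ℕ} (σ r : ℝ) (hσ : σ = 1 ∨ σ = -1) (x : Euc m)
    (hx : ‖x‖ ≤ r) : ‖slc 0 0 σ 1 r x‖ ≤ r := by
  have h1 := norm_le_split 0 (slc 0 0 σ 1 r x)
  rw [prp_slc, slc_coord] at h1
  have h0 : prp (0 : Fin (m + 1)) 0 = 0 := by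
    have := prp_smul (0 : Fin (m + 1)) 0 (0 : Euc (m + 1))
    simpa using this
  have hσa : |σ| = 1 := by rcases hσ with rfl | rfl <;> norm_num
  rw [h0, zero_add] at h1
  have h2 : |(0 : Euc (m + 1)) 0 + σ * (-r + 1 * ‖x‖)| = r - ‖x‖ := by
    rw [PiLp.zero_apply, zero_add, abs_mul, hσa, one_mul, one_mul, abs_of_nonpos (by linarith)]
    ring
  rw [h2] at h1
  linarith

lemma prp_zero' {m : ℕ} (i : Fin (m + 1)) : prp i (0 : Euc (m + 1)) = 0 := by
  have := prp_smul i 0 (0 : Euc (m + 1))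
  simpa using this

lemma tip_lower {m : ℕ} {u : ℝ → ℝ} (hu : IsModelCusp u) (r : ℝ) (hr : 0 < r) (hr1 : r < 1)
    (p : Euc m) (hp : ‖p‖ ≤ r) :
    StarAt (cuspBall (m + 1) u) 0 0 1 1 2 (1 / 2) r 0 p := by
  intro z hz
  rw [mem_closedBall, dist_zero_right] at hz
  refine ⟨(norm_sub_le _ _).trans (by linarith), fun s hs => ?_⟩
  set x := p + s • (z - p) with hx
  have hn1 : ‖x‖ ≤ r := by
    have : x = (1 - s) • p + s • z := by rw [hx]; module
    rw [this]
    refine (norm_add_le _ _).trans ?_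
    rw [norm_smul, norm_smul, Real.norm_of_nonneg hs.1, Real.norm_of_nonneg (sub_nonneg.2 hs.2)]
    have f1 : (1 - s) * ‖p‖ ≤ (1 - s) * r := mul_le_mul_of_nonneg_left hp (sub_nonneg.2 hs.2)
    have f2 : s * ‖z‖ ≤ s * r := mul_le_mul_of_nonneg_left (by linarith) hs.1
    linarith
  rw [mem_cusp]
  refine ⟨(tip_norm 1 r (Or.inl rfl) x hn1).trans_lt hr1, ?_⟩
  rw [slc_coord, prp_slc, prp_zero', zero_add, PiLp.zero_apply, zero_add, one_mul, one_mul]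
  intro h
  have e : ‖x‖ = r := by linarith
  rw [e, neg_add_cancel, cusp_zero hu]
  exact hr

lemma tip_upper {m : ℕ} {u : ℝ → ℝ} (hu : IsModelCusp u) (r : ℝ) (hr : 0 < r) (hr1 : r < 1)
    (e : Euc m) (he : ‖e‖ = 1) (l : ℝ) (hl : 0 ≤ l) (hlr : l ≤ r) (hlu : u (r - l) < l) :
    StarAt (cuspBall (m + 1) u) 0 0 (-1) 1 2 (1 / 5) r ((3 / 4 * r) • e) (l • e) := by
  intro z hz
  rw [mem_closedBall, dist_eq_norm] at hz
  have hce : ‖(3 / 4 * r) • e‖ = 3 / 4 * r := by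
    rw [norm_smul, he, mul_one, Real.norm_of_nonneg (by positivity)]
  have hle : ‖l • e‖ = l := by rw [norm_smul, he, mul_one, Real.norm_of_nonneg hl]
  have hzn : ‖z‖ ≤ 19 / 20 * r := by
    have : z = (z - (3 / 4 * r) • e) + (3 / 4 * r) • e := by abel
    rw [this]
    refine (norm_add_le _ _).trans ?_
    rw [hce]; linarith
  have hee : inner ℝ e e = (1 : ℝ) := by rw [real_inner_self_eq_norm_sq, he]; norm_num
  have hze : 11 / 20 * r ≤ inner ℝ e z := by
    have h1 := (abs_real_inner_le_norm e (z - (3 / 4 * r) • e))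
    rw [he, one_mul, inner_sub_right, inner_smul_right, hee] at h1
    have := (abs_le.1 (h1.trans hz)).1
    linarith
  refine ⟨(norm_sub_le _ _).trans (by rw [hle]; linarith), fun s hs => ?_⟩
  set x := l • e + s • (z - l • e) with hx
  have hx2 : x = (1 - s) • (l • e) + s • z := by rw [hx]; module
  have hn1 : ‖x‖ ≤ r := by
    rw [hx2]
    refine (norm_add_le _ _).trans ?_
    rw [norm_smul (1 - s), hle, norm_smul s z, Real.norm_of_nonneg hs.1,
      Real.norm_of_nonneg (sub_nonneg.2 hs.2)]
    have f1 : (1 - s) * l ≤ (1 - s) * r := mul_le_mul_of_nonneg_left hlr (sub_nonneg.2 hs.2)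
    have f2 : s * ‖z‖ ≤ s * r := mul_le_mul_of_nonneg_left (by linarith) hs.1
    linarith
  have hxe : (1 - s) * l + s * inner ℝ e z ≤ ‖x‖ := by
    have h1 := real_inner_le_norm e x
    rw [he, one_mul] at h1
    refine le_trans (le_of_eq ?_) h1
    rw [hx2, inner_add_right, inner_smul_right, inner_smul_right, inner_smul_right, hee]; ring
  rw [mem_cusp]
  refine ⟨(tip_norm (-1) r (Or.inr rfl) x hn1).trans_lt hr1, ?_⟩
  rw [slc_coord, prp_slc, prp_zero', zero_add, PiLp.zero_apply, zero_add, one_mul]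
  have e1 : -1 * (-r + ‖x‖) = r - ‖x‖ := by ring
  rw [e1]
  intro h
  rcases le_total l (inner ℝ e z) with hc | hc
  · have h2 : l ≤ ‖x‖ := by
      have := mul_le_mul_of_nonneg_left hc hs.1
      linarith
    have h3 := hu.strictMonoOn.monotoneOn (mem_Ici.2 h) (mem_Ici.2 (sub_nonneg.2 hlr))
      (by linarith : r - ‖x‖ ≤ r - l)
    linarith
  · have h2 : inner ℝ e z ≤ ‖x‖ := by
      have := mul_le_mul_of_nonneg_left hc (sub_nonneg.2 hs.2)
      linarith
    have h3 := cusp_le_self hu h (by linarith [norm_nonneg x])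
    linarith

lemma cuts_tip {m : ℕ} {u : ℝ → ℝ} (hu : IsModelCusp u)
    (hΩb : volume (cuspBall (m + 1) u) ≠ ⊤)
    (g : Euc (m + 1) → Euc (m + 1)) (hgc : ContinuousOn g (cuspBall (m + 1) u))
    (R : ℝ) (hgb : ∀ x ∈ cuspBall (m + 1) u, ‖g x‖ ≤ R)
    (Dg : Euc (m + 1) → Matrix (Fin (m + 1)) (Fin (m + 1)) ℝ)
    (hS : MemSobolev ((m + 1 : ℕ) : ℝ) (cuspBall (m + 1) u) g Dg) :
    SmallCuts (cuspBall (m + 1) u) g 0 := by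
  set Ω := cuspBall (m + 1) u with hΩdef
  have hΩ : IsOpen Ω := isOpen_cusp hu
  obtain ⟨Φ1, hm1, hi1, hΦ1⟩ := slice_vec Ω hΩ hΩb g hgc R hgb Dg hS 0 0 1 1 2
    (1 / 2) (Or.inl rfl) (by positivity) (by positivity) (by positivity)
  obtain ⟨Φ2, hm2, hi2, hΦ2⟩ := slice_vec Ω hΩ hΩb g hgc R hgb Dg hS 0 0 (-1) 1 2
    (1 / 5) (Or.inr rfl) (by positivity) (by positivity) (by positivity)
  intro ε hε
  have hm : (0 : ℝ) < m + 1 := by positivity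
  have hsum : ∫⁻ r, (Φ1 r + Φ2 r) < ⊤ := by
    rw [lintegral_add_left hm1]
    exact ENNReal.add_lt_top.2 ⟨hi1, hi2⟩
  obtain ⟨r, hr, hrlt, hrΦ⟩ := exists_good_radius (fun r => Φ1 r + Φ2 r) hsum (min 1 ε)
    ((ε / 3 / (m + 1)) ^ (m + 1)) (by positivity) (by positivity)
  have hr1 : r < 1 := hrlt.trans_le (min_le_left _ _)
  have hr2 : r ≤ ε := (hrlt.trans_le (min_le_right _ _)).le
  have o1 := hΦ1 r hr (ε / 3 / (m + 1)) (by positivity)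
    (le_trans (by gcongr; exact le_self_add) hrΦ)
  have o2 := hΦ2 r hr (ε / 3 / (m + 1)) (by positivity)
    (le_trans (by gcongr; exact le_add_self) hrΦ)
  rw [mul_div_cancel₀ _ hm.ne'] at o1 o2
  set N : Euc (m + 1) → ℝ := fun y => |y 0| + ‖prp 0 y‖ with hN
  have hNc : Continuous N := by
    have : Continuous fun y : Euc (m + 1) => |y 0| := by fun_prop
    exact this.add (continuous_prp 0).norm
  have hNn : ∀ y, dist y 0 ≤ N y := fun y => by
    rw [dist_zero_right]; exact norm_le_split 0 y
  refine ⟨Ω ∩ {y | N y = r}, Ω ∩ {y | N y < r}, Ω ∩ {y | r < N y}, fun y hy => hy.1,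
    fun y hy => ?_, ?_, ?_, ?_, ?_, ?_, ?_, ?_⟩
  · exact (hNn y).trans (le_trans (le_of_eq hy.2) hr2)
  · have hkey : ∀ y ∈ Ω, N y = r → ∃ x : Euc m, ‖x‖ ≤ r ∧
        ‖g y - g (slc 0 0 1 1 r x)‖ ≤ ε / 3 := by
      intro y hy hyN
      simp only [hN] at hyN
      rcases le_or_gt (y 0) 0 with h0 | h0
      · rw [abs_of_nonpos h0] at hyN
        refine ⟨prp 0 y, by linarith, ?_⟩
        have := eq_slc 0 0 y 1 1 r (Or.inl rfl) (by
          rw [prp_zero', sub_zero, PiLp.zero_apply]; linarith)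
        rw [prp_zero', sub_zero] at this
        rw [← this]; simp; positivity
      · rw [abs_of_pos h0] at hyN
        have hyu := (mem_cusp.1 hy).2 h0.le
        set p := prp 0 y with hp
        have hpn : 0 < ‖p‖ := lt_of_le_of_lt (hu.mapsTo (mem_Ici.2 h0.le)) hyu
        set e : Euc m := ‖p‖⁻¹ • p with hedef
        have he : ‖e‖ = 1 := by
          rw [hedef, norm_smul, norm_inv, norm_norm, inv_mul_cancel₀ hpn.ne']
        have hpe : ‖p‖ • e = p := by
          rw [hedef, smul_smul, mul_inv_cancel₀ hpn.ne', one_smul]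
        have hy0 : y 0 = r - ‖p‖ := by linarith
        rw [hy0] at hyu
        have s1 := tip_upper hu r hr hr1 e he ‖p‖ hpn.le (by linarith) hyu
        have s2 := tip_upper hu r hr hr1 e he r hr.le le_rfl (by
          rw [sub_self, cusp_zero hu]; exact hr)
        have hb := o2 _ _ _ s1 s2
        rw [hpe] at hb
        have h1 := eq_slc 0 0 y (-1) 1 r (Or.inr rfl) (by
          rw [prp_zero', sub_zero, PiLp.zero_apply]; linarith)
        rw [prp_zero', sub_zero] at h1
        have hren : ‖r • e‖ = r := by rw [norm_smul, he, mul_one, Real.norm_of_nonneg hr.le]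
        have h2 : slc 0 0 (-1) 1 r (r • e) = slc 0 0 1 1 r (r • e) := by
          simp only [slc, hren]; norm_num
        rw [← h1, h2] at hb
        exact ⟨r • e, hren.le, hb⟩
    intro y hy y' hy'
    obtain ⟨x, hx, h1⟩ := hkey y hy.1 hy.2
    obtain ⟨x', hx', h2⟩ := hkey y' hy'.1 hy'.2
    have h3 := o1 0 x x' (tip_lower hu r hr hr1 x hx) (tip_lower hu r hr hr1 x' hx')
    rw [← dist_eq_norm] at h1 h2 h3
    have h4 := dist_triangle4 (g y) (g (slc 0 0 1 1 r x)) (g (slc 0 0 1 1 r x')) (g y')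
    rw [dist_comm (g (slc 0 0 1 1 r x')) (g y')] at h4
    linarith
  · refine Filter.inter_mem self_mem_nhdsWithin (mem_nhdsWithin_of_mem_nhds ?_)
    refine (isOpen_lt hNc continuous_const).mem_nhds ?_
    simp [hN, prp_zero', hr]
  · exact fun y hy => (hNn y).trans (le_trans (le_of_lt hy.2) hr2)
  · exact hΩ.inter (isOpen_lt hNc continuous_const)
  · exact hΩ.inter (isOpen_lt continuous_const hNc)
  · rw [Set.disjoint_left]
    rintro y ⟨-, h1⟩ ⟨-, h2⟩
    exact lt_asymm (show N y < r from h1) h2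
  · rintro y ⟨hy, hyS⟩
    rcases lt_trichotomy (N y) r with h | h | h
    · exact Or.inl ⟨hy, h⟩
    · exact absurd ⟨hy, h⟩ hyS
    · exact Or.inr ⟨hy, h⟩

/-! ### Non-separation and cone conditions for the two model domains -/

lemma exists_perp {m : ℕ} (hm : 2 ≤ m) (x : Euc m) : ∃ v : Euc m, inner ℝ v x = 0 ∧ ‖v‖ = 1 / 2 := by
  have hne : (Submodule.span ℝ {x})ᗮ ≠ ⊥ := by
    intro h
    rw [Submodule.orthogonal_eq_bot_iff] at h
    have h1 := finrank_span_le_card (R := ℝ) ({x} : Set (Euc m))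
    rw [h, finrank_top, finrank_euclideanSpace_fin] at h1
    simp at h1
    omega
  obtain ⟨v, hv, hv0⟩ := Submodule.exists_mem_ne_zero_of_ne_bot hne
  rw [Submodule.mem_orthogonal_singleton_iff_inner_left] at hv
  have hvn : ‖v‖ ≠ 0 := norm_ne_zero_iff.2 hv0
  refine ⟨(1 / 2 * ‖v‖⁻¹) • v, by rw [inner_smul_left, hv, mul_zero], ?_⟩
  rw [norm_smul, norm_mul, norm_inv, norm_norm, mul_assoc, inv_mul_cancel₀ hvn]
  norm_num

lemma noSep_ball {m : ℕ} (hm : 2 ≤ m) : NoSep (ball (0 : Euc m) 1) := by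
  refine noSep_of_star _ 0 (by simp) (fun y hy => ?_) fun a ha => ?_
  · rw [mem_ball, dist_zero_right] at hy
    rw [sub_zero]; linarith
  · obtain ⟨v, h1, h2⟩ := exists_perp hm a
    have h0 : (0 : Euc m) ∈ ball (0 : Euc m) 1 := by simp
    have hv : 0 + v ∈ ball (0 : Euc m) 1 := by
      rw [zero_add, mem_ball, dist_zero_right, h2]; norm_num
    refine ⟨v, by rwa [sub_zero], h2, ?_, ?_, ?_⟩
    · exact (convex_ball _ _).segment_subset ha h0
    · exact (convex_ball _ _).segment_subset ha hv
    · exact (convex_ball _ _).segment_subset h0 hv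

lemma cusp_segment {m : ℕ} {u : ℝ → ℝ} (hu : IsModelCusp u) (a b : Euc (m + 1))
    (ha : a ∈ cuspBall (m + 1) u) (hb : ‖b‖ < 1) (hb0 : b 0 = -(1 / 2))
    (hab : inner ℝ (prp 0 a) (prp 0 b) = (0 : ℝ)) : segment ℝ a b ⊆ cuspBall (m + 1) u := by
  intro z hz
  have hzb : ‖z‖ < 1 := by
    have := (convex_ball (0 : Euc (m + 1)) 1).segment_subset
      (mem_ball_zero_iff.2 (mem_cusp.1 ha).1) (mem_ball_zero_iff.2 hb) hz
    simpa using this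
  obtain ⟨l, s, hl, hs, hls, rfl⟩ := hz
  refine mem_cusp.2 ⟨hzb, fun h => ?_⟩
  have e0 : (l • a + s • b) 0 = l * a 0 - s / 2 := by
    simp [hb0]; ring
  rw [e0] at h ⊢
  have hl0 : 0 < l := by
    rcases hl.lt_or_eq with h1 | h1
    · exact h1
    · rw [← h1] at h hls; linarith
  have hla : 0 ≤ l * a 0 := by linarith
  have ha0 : 0 ≤ a 0 := nonneg_of_mul_nonneg_right hla hl0
  have h1 := (mem_cusp.1 ha).2 ha0
  have h2 := hu.strictMonoOn.monotoneOn (mem_Ici.2 h) (mem_Ici.2 hla)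
    (by linarith : l * a 0 - s / 2 ≤ l * a 0)
  have h3 := cusp_smul_le hu hl (by linarith : l ≤ 1) ha0
  have h4 : l * u (a 0) < l * ‖prp 0 a‖ := mul_lt_mul_of_pos_left h1 hl0
  have h5 : l * ‖prp 0 a‖ ≤ ‖prp 0 (l • a + s • b)‖ := by
    refine le_of_sq_le ?_ (norm_nonneg _)
    rw [prp_add, prp_smul, prp_smul, norm_add_sq_real, inner_smul_left, inner_smul_right, hab,
      norm_smul, Real.norm_of_nonneg hl]
    have := sq_nonneg ‖s • prp 0 b‖
    simp only [mul_zero, add_zero]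
    linarith
  linarith

lemma noSep_cusp {m : ℕ} (hm : 2 ≤ m) {u : ℝ → ℝ} (hu : IsModelCusp u) :
    NoSep (cuspBall (m + 1) u) := by
  set w : Euc (m + 1) := insE 0 (-(1 / 2)) 0 with hw
  have hw0 : w 0 = -(1 / 2) := insE_self _ _ _
  have hwp : prp 0 w = 0 := prp_insE _ _ _
  have hwn : ‖w‖ ≤ 1 / 2 := by
    have := norm_insE_le (0 : Fin (m + 1)) (-(1 / 2)) (0 : Euc m)
    refine this.trans_eq ?_
    rw [norm_zero, add_zero, abs_neg, abs_of_pos (by norm_num)]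
  have hwΩ : w ∈ cuspBall (m + 1) u := by
    refine mem_cusp.2 ⟨by linarith, fun h => ?_⟩
    rw [hw0] at h; norm_num at h
  refine noSep_of_star _ w hwΩ (fun y hy => ?_) fun a ha => ?_
  · have := (mem_cusp.1 hy).1
    exact (norm_sub_le _ _).trans (by linarith)
  · obtain ⟨y, h1, h2⟩ := exists_perp hm (prp 0 a)
    set v : Euc (m + 1) := insE 0 0 y with hv
    have hv0 : v 0 = 0 := insE_self _ _ _
    have hvp : prp 0 v = y := prp_insE _ _ _
    have hvn : ‖v‖ = 1 / 2 := by
      have := norm_sq_split 0 v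
      rw [hv0, hvp, h2] at this
      have h3 : ‖v‖ ^ 2 = (1 / 2) ^ 2 := by rw [this]; norm_num
      exact (pow_left_inj₀ (norm_nonneg _) (by norm_num) two_ne_zero).1 h3
    have hwv0 : (w + v) 0 = -(1 / 2) := by rw [PiLp.add_apply, hw0, hv0, add_zero]
    have hwvp : prp 0 (w + v) = y := by rw [prp_add, hwp, hvp, zero_add]
    have hwvn : ‖w + v‖ < 1 := by
      have := norm_sq_split 0 (w + v)
      rw [hwv0, hwvp, h2] at this
      nlinarith [norm_nonneg (w + v)]
    refine ⟨v, ?_, hvn, ?_, ?_, ?_⟩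
    · rw [inner_split 0, hv0, hvp, prp_sub, hwp, sub_zero, h1]; simp
    · exact cusp_segment hu a w ha (by linarith) hw0 (by rw [hwp, inner_zero_right])
    · exact cusp_segment hu a (w + v) ha hwvn hwv0 (by rw [hwvp, real_inner_comm]; exact h1)
    · exact cusp_segment hu w (w + v) hwΩ hwvn hwv0 (by rw [hwp, inner_zero_left])

lemma ball_cone {m : ℕ} (y0 : Euc (m + 1)) (hy0 : ‖y0‖ ≤ 1) (i : Fin (m + 1)) (σ K r0 : ℝ)
    (hσ : σ = 1 ∨ σ = -1) (ha : 0 < σ * y0 i) (hK : 3 / (σ * y0 i) ≤ K)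
    (hr0 : r0 ≤ (σ * y0 i) / 2) : ConeCond (ball 0 1) i y0 σ K r0 := by
  intro y hy hyb y' hyb' hd
  set a := σ * y0 i with hadef
  have hss : σ * σ = 1 := by rcases hσ with rfl | rfl <;> norm_num
  have hσa : |σ| = 1 := by rcases hσ with rfl | rfl <;> norm_num
  have hK0 : 0 < K := lt_of_lt_of_le (by positivity) hK
  have ha1 : a ≤ 1 := by
    calc a ≤ |a| := le_abs_self _
      _ = |y0 i| := by rw [hadef, abs_mul, hσa, one_mul]
      _ ≤ 1 := (abs_coord_le i y0).trans hy0
  have hco : ∀ z ∈ ball y0 r0, a / 2 < σ * z i ∧ ‖prp i z‖ ≤ 3 / 2 := by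
    intro z hz
    rw [mem_ball, dist_eq_norm] at hz
    constructor
    · have h1 := (abs_coord_le i (z - y0)).trans hz.le
      have h2 : |σ * (z - y0) i| ≤ r0 := by rw [abs_mul, hσa, one_mul]; exact h1
      have h1' := lt_of_le_of_lt (abs_coord_le i (z - y0)) hz
      have h2 : |σ * (z - y0) i| < r0 := by rw [abs_mul, hσa, one_mul]; exact h1'
      rw [PiLp.sub_apply, mul_sub] at h2
      have := (abs_lt.1 h2).1
      linarith
    · refine (norm_prp_le i z).trans ?_
      have : z = (z - y0) + y0 := by abel
      rw [this]
      refine (norm_add_le _ _).trans ?_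
      linarith
  obtain ⟨c1, c2⟩ := hco y hyb
  obtain ⟨d1, d2⟩ := hco y' hyb'
  rw [mem_ball_zero_iff] at hy ⊢
  have hq : 3 * ‖prp i y' - prp i y‖ ≤ a * (σ * (y i - y' i)) := by
    have h1 : 3 ≤ K * a := by rwa [div_le_iff₀ ha] at hK
    calc 3 * ‖prp i y' - prp i y‖ ≤ (K * a) * ‖prp i y' - prp i y‖ := by gcongr
      _ = a * (K * ‖prp i y' - prp i y‖) := by ring
      _ ≤ _ := by gcongr
  have hd0 : 0 ≤ σ * (y i - y' i) := le_trans (by positivity) hd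
  have htri : ‖prp i y'‖ - ‖prp i y‖ ≤ ‖prp i y' - prp i y‖ := norm_sub_norm_le _ _
  have h1 := norm_sq_split i y
  have h2 := norm_sq_split i y'
  have h3 : (y i) ^ 2 - (y' i) ^ 2 = (σ * (y i - y' i)) * (σ * y i + σ * y' i) := by
    have : (σ * (y i - y' i)) * (σ * y i + σ * y' i) = (σ * σ) * ((y i) ^ 2 - (y' i) ^ 2) := by ring
    rw [this, hss, one_mul]
  have h4 : a * (σ * (y i - y' i)) ≤ (σ * (y i - y' i)) * (σ * y i + σ * y' i) := by
    rw [mul_comm a]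
    exact mul_le_mul_of_nonneg_left (by linarith) hd0
  have h5 : ‖prp i y'‖ ^ 2 - ‖prp i y‖ ^ 2 ≤ 3 * ‖prp i y' - prp i y‖ := by
    have : ‖prp i y'‖ ^ 2 - ‖prp i y‖ ^ 2 =
      (‖prp i y'‖ - ‖prp i y‖) * (‖prp i y'‖ + ‖prp i y‖) := by ring
    rw [this]
    calc _ ≤ ‖prp i y' - prp i y‖ * (‖prp i y'‖ + ‖prp i y‖) := by gcongr
      _ ≤ ‖prp i y' - prp i y‖ * 3 := by gcongr; linarith
      _ = _ := by ring
  have h6 : ‖y'‖ ^ 2 ≤ ‖y‖ ^ 2 := by linarith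
  exact lt_of_le_of_lt (le_of_sq_le h6 (norm_nonneg _)) hy

lemma exists_ball_cone {m : ℕ} (y0 : Euc (m + 1)) (hy0 : ‖y0‖ ≤ 1) (hne : y0 ≠ 0) (δ : ℝ)
    (hδ : 0 < δ) : ∃ i σ K r0, (σ = 1 ∨ σ = -1) ∧ (1 : ℝ) ≤ K ∧ 0 < r0 ∧ r0 ≤ δ ∧
      ConeCond (ball 0 1) i y0 σ K r0 := by
  obtain ⟨i, hi⟩ : ∃ i, y0 i ≠ 0 := by
    by_contra! hc
    exact hne (by ext i; simpa using hc i)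
  obtain ⟨σ, hσ, hpos⟩ : ∃ σ : ℝ, (σ = 1 ∨ σ = -1) ∧ 0 < σ * y0 i := by
    rcases lt_or_gt_of_ne hi with h | h
    · exact ⟨-1, Or.inr rfl, by linarith⟩
    · exact ⟨1, Or.inl rfl, by linarith⟩
  refine ⟨i, σ, max 1 (3 / (σ * y0 i)), min δ ((σ * y0 i) / 2), hσ, le_max_left _ _,
    by positivity, min_le_left _ _, ?_⟩
  exact ball_cone y0 hy0 i σ _ _ hσ hpos (le_max_right _ _) (min_le_right _ _)

lemma cusp_cone {m : ℕ} {u : ℝ → ℝ} (hu : IsModelCusp u) (y0 : Euc (m + 1)) (hy0 : ‖y0‖ ≤ 1)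
    (hpos : 0 < y0 0) : ∃ K r0 : ℝ, 1 ≤ K ∧ 0 < r0 ∧ ConeCond (cuspBall (m + 1) u) 0 y0 1 K r0 := by
  set b := u (y0 0 / 2) with hb
  have hb0 : 0 < b := by
    rw [← cusp_zero hu]
    exact hu.strictMonoOn (mem_Ici.2 le_rfl) (mem_Ici.2 (by positivity)) (by positivity)
  have ht1 : y0 0 ≤ 1 := (le_abs_self _).trans ((abs_coord_le 0 y0).trans hy0)
  refine ⟨max 1 (max (3 / y0 0) (2 / b)), y0 0 / 2, le_max_left _ _, by positivity, ?_⟩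
  set K := max 1 (max (3 / y0 0) (2 / b)) with hK
  have hK1 : 3 / y0 0 ≤ K := (le_max_left _ _).trans (le_max_right _ _)
  have hK2 : 2 / b ≤ K := (le_max_right _ _).trans (le_max_right _ _)
  have hbc := ball_cone y0 hy0 0 1 K (y0 0 / 2) (Or.inl rfl) (by rwa [one_mul])
    (by rwa [one_mul]) (by rw [one_mul])
  intro y hy hyb y' hyb' hd
  obtain ⟨hy1, hy2⟩ := mem_cusp.1 hy
  have hn := hbc y (mem_ball_zero_iff.2 hy1) hyb y' hyb' hd
  rw [mem_ball_zero_iff] at hn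
  refine mem_cusp.2 ⟨hn, fun h0 => ?_⟩
  have hlow : ∀ z ∈ ball y0 (y0 0 / 2), y0 0 / 2 < z 0 := by
    intro z hz
    rw [mem_ball, dist_eq_norm] at hz
    have h1 := lt_of_le_of_lt (abs_coord_le 0 (z - y0)) hz
    rw [PiLp.sub_apply] at h1
    have := (abs_lt.1 h1).1
    linarith
  have ht := hlow y hyb
  have ht' := hlow y' hyb'
  have hty1 : y 0 ≤ 1 := (le_abs_self _).trans ((abs_coord_le 0 y).trans hy1.le)
  have htp : 0 < y 0 := by linarith
  have hyu := hy2 htp.le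
  rw [one_mul] at hd
  have hle : y' 0 ≤ y 0 := by
    have : 0 ≤ K * ‖prp 0 y' - prp 0 y‖ := by positivity
    linarith
  have hbu : b ≤ u (y 0) :=
    hu.strictMonoOn.monotoneOn (mem_Ici.2 (by positivity)) (mem_Ici.2 htp.le) ht.le
  have h1 := cusp_smul_le hu (l := y' 0 / y 0) (t := y 0) (by positivity)
    ((div_le_one htp).2 hle) htp.le
  rw [div_mul_cancel₀ _ htp.ne'] at h1
  have h2 : (y 0 - y' 0) * (b / 2) ≤ u (y 0) - u (y' 0) := by
    have e1 : u (y 0) - y' 0 / y 0 * u (y 0) = (y 0 - y' 0) * (u (y 0) / y 0) := by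
      field_simp
    have e2 : b / 2 ≤ u (y 0) / y 0 := by
      rw [div_le_div_iff₀ two_pos htp]
      nlinarith
    have := mul_le_mul_of_nonneg_left e2 (sub_nonneg.2 hle)
    linarith
  have h3 : ‖prp 0 y' - prp 0 y‖ ≤ (y 0 - y' 0) * (b / 2) := by
    have e1 : 2 ≤ K * b := by rwa [div_le_iff₀ hb0] at hK2
    have e2 : 2 * ‖prp 0 y' - prp 0 y‖ ≤ (K * b) * ‖prp 0 y' - prp 0 y‖ := by gcongr
    have e3 : b * (K * ‖prp 0 y' - prp 0 y‖) ≤ b * (y 0 - y' 0) := by gcongr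
    linarith
  have h4 : ‖prp 0 y‖ - ‖prp 0 y'‖ ≤ ‖prp 0 y' - prp 0 y‖ := by
    rw [norm_sub_rev]; exact norm_sub_norm_le _ _
  linarith

lemma cone_local {m : ℕ} {Ω Ω' : Set (Euc (m + 1))} {i : Fin (m + 1)} {y0 : Euc (m + 1)}
    {σ K r0 : ℝ} (h : ConeCond Ω i y0 σ K r0) (he : ∀ y ∈ ball y0 r0, (y ∈ Ω ↔ y ∈ Ω')) :
    ConeCond Ω' i y0 σ K r0 := fun y hy hyb y' hyb' hd =>
  (he y' hyb').1 (h y ((he y hyb).2 hy) hyb y' hyb' hd)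

lemma norm_le_of_closure {n : ℕ} {Ω : Set (Euc n)} (hΩ : Ω ⊆ ball 0 1) {y : Euc n}
    (hy : y ∈ closure Ω) : ‖y‖ ≤ 1 := by
  have := closure_minimal (hΩ.trans ball_subset_closedBall) isClosed_closedBall hy
  simpa using this

lemma cusp_subset {m : ℕ} {u : ℝ → ℝ} : cuspBall (m + 1) u ⊆ ball 0 1 := fun _ hy =>
  mem_ball_zero_iff.2 (mem_cusp.1 hy).1

lemma cuts_ball {m : ℕ} (g : Euc (m + 1) → Euc (m + 1)) (hgc : ContinuousOn g (ball 0 1)) (R : ℝ)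
    (hgb : ∀ x ∈ ball (0 : Euc (m + 1)) 1, ‖g x‖ ≤ R)
    (Dg : Euc (m + 1) → Matrix (Fin (m + 1)) (Fin (m + 1)) ℝ)
    (hS : MemSobolev ((m + 1 : ℕ) : ℝ) (ball 0 1) g Dg)
    (y0 : Euc (m + 1)) (hy0 : y0 ∈ closure (ball (0 : Euc (m + 1)) 1))
    (hy0' : y0 ∉ ball (0 : Euc (m + 1)) 1) : SmallCuts (ball 0 1) g y0 := by
  have hne : y0 ≠ 0 := by rintro rfl; simp at hy0'
  obtain ⟨i, σ, K, r0, hσ, hK, hr0, -, hc⟩ :=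
    exists_ball_cone y0 (norm_le_of_closure subset_rfl hy0) hne 1 one_pos
  exact cuts_of_cone _ isOpen_ball measure_ball_lt_top.ne g hgc R hgb Dg hS y0 hy0 hy0' i σ K r0 hσ
    hK hr0 hc

lemma cuts_cusp {m : ℕ} {u : ℝ → ℝ} (hu : IsModelCusp u)
    (g : Euc (m + 1) → Euc (m + 1)) (hgc : ContinuousOn g (cuspBall (m + 1) u))
    (R : ℝ) (hgb : ∀ x ∈ cuspBall (m + 1) u, ‖g x‖ ≤ R)
    (Dg : Euc (m + 1) → Matrix (Fin (m + 1)) (Fin (m + 1)) ℝ)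
    (hS : MemSobolev ((m + 1 : ℕ) : ℝ) (cuspBall (m + 1) u) g Dg)
    (y0 : Euc (m + 1)) (hy0 : y0 ∈ closure (cuspBall (m + 1) u))
    (hy0' : y0 ∉ cuspBall (m + 1) u) : SmallCuts (cuspBall (m + 1) u) g y0 := by
  have hvol : volume (cuspBall (m + 1) u) ≠ ⊤ :=
    ((measure_mono cusp_subset).trans_lt measure_ball_lt_top).ne
  by_cases hne : y0 = 0
  · rw [hne]; exact cuts_tip hu hvol g hgc R hgb Dg hS
  have hn := norm_le_of_closure cusp_subset hy0
  rcases lt_or_ge 0 (y0 0) with hpos | hpos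
  · obtain ⟨K, r0, hK, hr0, hc⟩ := cusp_cone hu y0 hn hpos
    exact cuts_of_cone _ (isOpen_cusp hu) hvol g hgc R hgb Dg hS y0 hy0 hy0' 0 1 K r0
      (Or.inl rfl) hK hr0 hc
  · have hC : y0 ∈ {y : Euc (m + 1) | 0 ≤ y 0 ∧ ‖prp 0 y‖ ≤ u (y 0)}ᶜ := by
      rintro ⟨h1, h2⟩
      have h0 : y0 0 = 0 := le_antisymm hpos h1
      rw [h0, cusp_zero hu] at h2
      apply hne
      have := norm_le_split 0 y0
      rw [h0, abs_zero, zero_add] at this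
      exact norm_le_zero_iff.1 (this.trans h2)
    obtain ⟨δ, hδ, hsub⟩ := Metric.isOpen_iff.1 (closed_cusp hu).isOpen_compl y0 hC
    obtain ⟨i, σ, K, r0, hσ, hK, hr0, hle, hc⟩ := exists_ball_cone y0 hn hne δ hδ
    refine cuts_of_cone _ (isOpen_cusp hu) hvol g hgc R hgb Dg hS y0 hy0 hy0' i σ K r0
      hσ hK hr0 (cone_local hc fun y hy => ?_)
    rw [cusp_eq]
    exact ⟨fun h => ⟨h, hsub (ball_subset_ball hle hy)⟩, fun h => h.1⟩

lemma main_succ {m : ℕ} (hm : 2 ≤ m) (u : ℝ → ℝ) (hu : IsModelCusp u)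
    (h f : Euc (m + 1) → Euc (m + 1))
    (hhf : IsHomeoOn h f (unitBall (m + 1)) (cuspBall (m + 1) u))
    (Dh Df : Euc (m + 1) → Matrix (Fin (m + 1)) (Fin (m + 1)) ℝ)
    (hSobH : MemSobolev ((m + 1 : ℕ) : ℝ) (unitBall (m + 1)) h Dh)
    (hSobF : MemSobolev ((m + 1 : ℕ) : ℝ) (cuspBall (m + 1) u) f Df) :
    ∃ H G, IsHomeoOn H G (closure (unitBall (m + 1))) (closure (cuspBall (m + 1) u)) ∧
      EqOn H h (unitBall (m + 1)) := by
  refine extension_of_limits _ _ h f hhf (fun x hx hx' => ?_) (fun y hy hy' => ?_)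
  · refine limit_exists _ _ h f hhf x hx hx' ?_ (noSep_cusp hm hu)
    exact cuts_ball h hhf.continuousOn 1
      (fun z hz => (mem_cusp.1 (hhf.mapsTo hz)).1.le) Dh hSobH x hx hx'
  · refine limit_exists _ _ f h ⟨hhf.mapsTo_inv, hhf.mapsTo, hhf.right_inv, hhf.left_inv,
      hhf.continuousOn_inv, hhf.continuousOn⟩ y hy hy' ?_ (noSep_ball (by omega))
    exact cuts_cusp hu f hhf.continuousOn_inv 1
      (fun z hz => (mem_ball_zero_iff.1 (hhf.mapsTo_inv hz)).le) Df hSobF y hy hy'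

/-- Every homeomorphism `h : 𝔹 → 𝔹_u` of bi-conformal energy admits a
homeomorphic extension to the closures. -/
theorem stmt_7 {n : ℕ} [NeZero n] (hn : 3 ≤ n) (u : ℝ → ℝ) (hu : IsModelCusp u)
    (h f : Euc n → Euc n) (hhf : IsHomeoOn h f (unitBall n) (cuspBall n u))
    (Dh Df : Euc n → Matrix (Fin n) (Fin n) ℝ)
    (hSobH : MemSobolev (n : ℝ) (unitBall n) h Dh)
    (hSobF : MemSobolev (n : ℝ) (cuspBall n u) f Df) :
    ∃ H G : Euc n → Euc n,
      IsHomeoOn H G (closure (unitBall n)) (closure (cuspBall n u)) ∧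
      Set.EqOn H h (unitBall n) := by
  obtain ⟨m, rfl⟩ : ∃ m, n = m + 1 := ⟨n - 1, by omega⟩
  exact main_succ (by omega) u hu h f hhf Dh Df hSobH hSobF
end
end
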